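/- Let F ∈ R^{l×l} with d_l(F) = det F associated to d_1^{p} d_2^{q}, where d_1 = x_1 − f_1(x_2,...,x_n), d_2 = x_2 − f_2(x_3,...,x_n) for some f_1 ∈ K[x_2,...,x_n], f_2 ∈ K[x_3,...,x_n], and p, q are positive integers. If J_i(F) = R for i = 1,2,...,l, then F is equivalent to its Smith normal form D = diag(d_1^{r_1}d_2^{s_1}, d_1^{r_2}d_2^{s_2},..., d_1^{r_l}d_2^{s_l}), where d_i(F) is associated to d_1^{p_i}d_2^{q_i}, p_0 = q_0 = 0, r_i = p_i − p_{i−1}, s_i = q_i − q_{i−1} for i = 1,...,l, and moreover r_1 ≤ r_2 ≤ ... ≤ r_l and s_1 ≤ s_2 ≤ ... ≤ s_l. -/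

import Mathlib

open Matrix MvPolynomial

/-- The set of `k × k` minors of a matrix: determinants of submatrices obtained by
choosing `k` rows and `k` columns. -/
def minorsSet {R : Type*} [CommRing R] {l m : ℕ} (k : ℕ)
    (F : Matrix (Fin l) (Fin m) R) : Set R :=
  { d | ∃ (ri : Fin k → Fin l) (ci : Fin k → Fin m),
      Function.Injective ri ∧ Function.Injective ci ∧ d = (F.submatrix ri ci).det }

/-- `d` is a greatest common divisor of the `k × k` minors of `F`. -/
def IsGcdMinors {R : Type*} [CommRing R] {l m : ℕ} (k : ℕ)
    (F : Matrix (Fin l) (Fin m) R) (d : R) : Prop :=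
  (∀ a ∈ minorsSet k F, d ∣ a) ∧ ∀ e : R, (∀ a ∈ minorsSet k F, e ∣ a) → e ∣ d

/-- `J_k(F) = R` : the ideal generated by the reduced `k`-th order minors
(the `k × k` minors divided by their g.c.d.) is the unit ideal. -/
def JEqTop {R : Type*} [CommRing R] {l m : ℕ} (k : ℕ)
    (F : Matrix (Fin l) (Fin m) R) : Prop :=
  ∃ d : R, IsGcdMinors k F d ∧ Ideal.span { b : R | d * b ∈ minorsSet k F } = ⊤

/-- The normal rank of a polynomial matrix: its rank over the fraction field. -/
noncomputable def normalRank {K : Type*} [Field K] {n l m : ℕ}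
    (F : Matrix (Fin l) (Fin m) (MvPolynomial (Fin n) K)) : ℕ :=
  (F.map (algebraMap (MvPolynomial (Fin n) K)
      (FractionRing (MvPolynomial (Fin n) K)))).rank

/-- Equivalence of matrices: `G = M * F * N` with `M`, `N` unimodular
(i.e. with determinant a unit, a nonzero constant). -/
def MatEquiv {R : Type*} [CommRing R] {l m : ℕ}
    (F G : Matrix (Fin l) (Fin m) R) : Prop :=
  ∃ (M : Matrix (Fin l) (Fin l) R) (N : Matrix (Fin m) (Fin m) R),
    IsUnit M.det ∧ IsUnit N.det ∧ G = M * F * N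

/-- A matrix is zero left prime (ZLP) if its maximal (row-size) order minors
generate the unit ideal. -/
def ZLP {R : Type*} [CommRing R] {l m : ℕ} (F : Matrix (Fin l) (Fin m) R) : Prop :=
  Ideal.span (minorsSet l F) = ⊤

/-- Two column vectors are in the same orbit under the general linear group. -/
def ColEquiv {R ι : Type*} [CommRing R] [Fintype ι] [DecidableEq ι] (v w : ι → R) : Prop :=
  ∃ M : (Matrix ι ι R)ˣ, (M : Matrix ι ι R) *ᵥ v = w

/-- The entries of a column vector generate the unit ideal. -/
def UnimodularCol {R ι : Type*} [CommRing R] [Fintype ι] (v : ι → R) : Prop :=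
  ∃ w : ι → R, w ⬝ᵥ v = 1

namespace ColEquiv

variable {R S ι κ : Type*} [CommRing R] [CommRing S] [Fintype ι] [DecidableEq ι]
  [Fintype κ] [DecidableEq κ]

theorem rfl' (v : ι → R) : ColEquiv v v := ⟨1, by simp⟩

theorem symm {v w : ι → R} (h : ColEquiv v w) : ColEquiv w v := by
  obtain ⟨M, rfl⟩ := h
  exact ⟨M⁻¹, by simp [Matrix.mulVec_mulVec]⟩

theorem trans {u v w : ι → R} (h : ColEquiv u v) (h' : ColEquiv v w) : ColEquiv u w := by
  obtain ⟨M, rfl⟩ := h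
  obtain ⟨N, rfl⟩ := h'
  exact ⟨N * M, by simp [Matrix.mulVec_mulVec]⟩

theorem of_isUnit_det (M : Matrix ι ι R) (hM : IsUnit M.det) (v : ι → R) :
    ColEquiv v (M *ᵥ v) := by
  obtain ⟨U, hU⟩ := (Matrix.isUnit_iff_isUnit_det M).2 hM
  exact ⟨U, by rw [hU]⟩

theorem map (f : R →+* S) {v w : ι → R} (h : ColEquiv v w) :
    ColEquiv (f ∘ v) (f ∘ w) := by
  obtain ⟨M, rfl⟩ := h
  refine ⟨Units.map (f.mapMatrix (m := ι)).toMonoidHom M, ?_⟩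
  ext i
  simp [Matrix.mulVec, dotProduct]

theorem comp_equiv (e : κ ≃ ι) {v w : ι → R} (h : ColEquiv v w) :
    ColEquiv (v ∘ e) (w ∘ e) := by
  obtain ⟨M, rfl⟩ := h
  refine ⟨Units.map (Matrix.reindexAlgEquiv R R e.symm).toAlgHom.toRingHom.toMonoidHom M, ?_⟩
  ext i
  simp [Matrix.mulVec, dotProduct, Matrix.reindexAlgEquiv, Matrix.reindex_apply]
  exact Fintype.sum_equiv e _ _ (fun _ => rfl)

theorem perm (σ : Equiv.Perm ι) (v : ι → R) : ColEquiv v (v ∘ σ) := by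
  convert of_isUnit_det (σ.permMatrix R) _ v using 1
  · ext i
    simp [Matrix.permMatrix_mulVec]
  · rw [Matrix.det_permutation]
    exact ((Equiv.Perm.sign σ).isUnit).map (Int.castRingHom R)

theorem single_single (i j : ι) :
    ColEquiv (Pi.single i (1 : R)) (Pi.single j (1 : R)) := by
  convert perm (Equiv.swap i j) (Pi.single i (1 : R)) using 1
  ext k
  simp only [Function.comp, Pi.single_apply, Equiv.swap_apply_def]
  grind

theorem unimodularCol {v w : ι → R} (h : ColEquiv v w) (hv : UnimodularCol v) :
    UnimodularCol w := by
  obtain ⟨M, rfl⟩ := h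
  obtain ⟨u, hu⟩ := hv
  refine ⟨u ᵥ* (↑M⁻¹ : Matrix ι ι R), ?_⟩
  rw [Matrix.dotProduct_mulVec, Matrix.vecMul_vecMul, ← Units.val_mul]
  simpa using hu

/-- A column with an invertible entry is equivalent to a standard basis vector. -/
theorem of_isUnit_apply (v : ι → R) (i : ι) (h : IsUnit (v i)) (j : ι) :
    ColEquiv v (Pi.single j 1) := by
  obtain ⟨u, hu⟩ := h
  refine trans (symm ?_) (single_single i j)
  obtain ⟨P, hP⟩ : ∃ P, P = Matrix.vecMulVec (v - Pi.single i 1) (Pi.single i 1) := ⟨_, rfl⟩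
  have hPP : P * P = ((u : R) - 1) • P := by
    ext a b
    simp [hP, Matrix.vecMulVec_mul_vecMulVec, Matrix.vecMulVec_apply, hu]
    ring
  have hinv : (↑u⁻¹ : R) • P * P = P - (↑u⁻¹ : R) • P := by
    rw [Matrix.smul_mul, hPP, smul_smul, mul_sub, u.inv_mul, mul_one, sub_smul, one_smul]
  have hinv' : P * (↑u⁻¹ : R) • P = P - (↑u⁻¹ : R) • P := by
    rw [Matrix.mul_smul, ← Matrix.smul_mul, hinv]
  refine ⟨⟨1 + P, 1 - (↑u⁻¹ : R) • P, ?_, ?_⟩, ?_⟩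
  · rw [mul_sub, add_mul, add_mul, hinv']
    simp
  · rw [mul_add, sub_mul, sub_mul, hinv]
    simp
  · rw [Units.val_mk, Matrix.add_mulVec, hP, Matrix.vecMulVec_mulVec, Matrix.one_mulVec]
    simp

end ColEquiv

namespace UnimodularCol

variable {R S ι κ : Type*} [CommRing R] [CommRing S] [Fintype ι] [Fintype κ]

theorem map (f : R →+* S) {v : ι → R} (h : UnimodularCol v) : UnimodularCol (f ∘ v) := by
  obtain ⟨w, hw⟩ := h
  refine ⟨f ∘ w, ?_⟩
  simpa [dotProduct] using congrArg f hw

theorem comp_equiv (e : κ ≃ ι) {v : ι → R} (h : UnimodularCol v) : UnimodularCol (v ∘ e) := by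
  obtain ⟨w, hw⟩ := h
  exact ⟨w ∘ e, by simpa using hw⟩

end UnimodularCol

/-- Artinian rings have stable range one. -/
theorem exists_isUnit_add_sum {S κ : Type*} [CommRing S] [IsArtinianRing S] [Fintype κ]
    (u : S) (w : κ → S) (h : ∃ (b : S) (a : κ → S), b * u + ∑ k, a k * w k = 1) :
    ∃ a : κ → S, IsUnit (u + ∑ k, a k * w k) := by
  classical
  obtain ⟨b, c, hbc⟩ := h
  have key : ∀ m : MaximalSpectrum S, ∃ a : κ → S, u + ∑ k, a k * w k ∉ m.asIdeal := by
    intro m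
    by_cases hu : u ∈ m.asIdeal
    · obtain ⟨k, hk⟩ : ∃ k, w k ∉ m.asIdeal := by
        by_contra! hcon
        refine m.isMaximal.ne_top ((Ideal.eq_top_iff_one _).2 ?_)
        rw [← hbc]
        exact add_mem (Ideal.mul_mem_left _ _ hu)
          (Ideal.sum_mem _ fun k _ => Ideal.mul_mem_left _ _ (hcon k))
      refine ⟨Pi.single k 1, fun hmem => hk ?_⟩
      have := (Ideal.add_mem_iff_right _ hu).1 hmem
      simpa [Pi.single_apply] using this
    · exact ⟨0, by simpa using hu⟩
  choose t ht using key
  have : Fintype (MaximalSpectrum S) := Fintype.ofFinite _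
  have hcop : ∀ i ∈ (Finset.univ : Finset (MaximalSpectrum S)), ∀ j ∈ Finset.univ, i ≠ j →
      IsCoprime i.asIdeal j.asIdeal := by
    intro i _ j _ hij
    rw [Ideal.isCoprime_iff_sup_eq]
    exact i.isMaximal.coprime_of_ne j.isMaximal (fun h => hij (MaximalSpectrum.ext h))
  have crt : ∀ k, ∃ y : S, ∀ m : MaximalSpectrum S, y - t m k ∈ m.asIdeal := by
    intro k
    exact Ideal.exists_forall_sub_mem_ideal
      (I := fun m : MaximalSpectrum S => m.asIdeal)
      (fun i j hij => hcop i (Finset.mem_univ _) j (Finset.mem_univ _) hij) (fun m => t m k)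
  choose a ha using crt
  refine ⟨a, ?_⟩
  by_contra hnu
  obtain ⟨M, hM, hmem⟩ := exists_max_ideal_of_mem_nonunits hnu
  refine ht ⟨M, hM⟩ ?_
  have : u + ∑ k, t ⟨M, hM⟩ k * w k =
      (u + ∑ k, a k * w k) - ∑ k, (a k - t ⟨M, hM⟩ k) * w k := by
    simp only [sub_mul, Finset.sum_sub_distrib]
    ring
  rw [this]
  exact sub_mem hmem (Ideal.sum_mem _ fun k _ => Ideal.mul_mem_right _ _ (ha k ⟨M, hM⟩))

/-- If `c` lies in the ideal generated by `f₀, f₁`, then the values of the column `f` at points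
congruent modulo `c` are equivalent. -/
theorem colEquiv_eval_of_mem_span {B κ : Type*} [CommRing B] [IsDomain B] [Fintype κ]
    [DecidableEq κ] (f : Fin 2 ⊕ κ → Polynomial B) (g₀ g₁ : Polynomial B) (c : B) (hc : c ≠ 0)
    (hg : g₀ * f (Sum.inl 0) + g₁ * f (Sum.inl 1) = Polynomial.C c) (b x : B) :
    ColEquiv (fun i => (f i).eval b) (fun i => (f i).eval (b + c * x)) := by
  have step : ∀ p : Polynomial B, ∃ h, p.eval (b + c * x) = p.eval b + c * h := by
    intro p
    obtain ⟨y, hy⟩ := Polynomial.sub_dvd_eval_sub (b + c * x) b p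
    exact ⟨x * y, by linear_combination hy⟩
  choose h hh using step
  have h1 : g₀.eval b * (f (Sum.inl 0)).eval b + g₁.eval b * (f (Sum.inl 1)).eval b = c := by
    simpa using congrArg (Polynomial.eval b) hg
  have h2 : g₀.eval (b + c * x) * (f (Sum.inl 0)).eval (b + c * x) +
      g₁.eval (b + c * x) * (f (Sum.inl 1)).eval (b + c * x) = c := by
    simpa using congrArg (Polynomial.eval (b + c * x)) hg
  rw [hh, hh, hh, hh] at h2
  obtain ⟨F0, hF0⟩ : ∃ y, y = (f (Sum.inl 0)).eval b := ⟨_, rfl⟩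
  obtain ⟨F1, hF1⟩ : ∃ y, y = (f (Sum.inl 1)).eval b := ⟨_, rfl⟩
  obtain ⟨G0, hG0⟩ : ∃ y, y = g₀.eval b := ⟨_, rfl⟩
  obtain ⟨G1, hG1⟩ : ∃ y, y = g₁.eval b := ⟨_, rfl⟩
  rw [← hF0, ← hF1, ← hG0, ← hG1] at h1 h2
  have h3 : h g₀ * F0 + G0 * h (f (Sum.inl 0)) + h g₁ * F1 + G1 * h (f (Sum.inl 1)) +
      c * (h g₀ * h (f (Sum.inl 0)) + h g₁ * h (f (Sum.inl 1))) = 0 := by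
    apply mul_left_cancel₀ hc
    linear_combination h2 - h1
  let m : Matrix (Fin 2) (Fin 2) B :=
    !![1 + h (f (Sum.inl 0)) * G0 + h g₁ * F1, h (f (Sum.inl 0)) * G1 - h g₁ * F0;
       h (f (Sum.inl 1)) * G0 - h g₀ * F1, 1 + h (f (Sum.inl 1)) * G1 + h g₀ * F0]
  have hdet : m.det = 1 := by
    simp only [m, Matrix.det_fin_two_of]
    linear_combination h3 + (h g₀ * h (f (Sum.inl 0)) + h g₁ * h (f (Sum.inl 1))) * h1
  let N : Matrix κ (Fin 2) B := Matrix.of fun k => ![h (f (Sum.inr k)) * G0, h (f (Sum.inr k)) * G1]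
  convert ColEquiv.of_isUnit_det (Matrix.fromBlocks m 0 N 1) ?_ _ using 1
  · ext i
    rcases i with i | k
    · fin_cases i
      · simp [Matrix.mulVec, dotProduct, m, hh, ← hF0, ← hF1]
        linear_combination (-h (f (Sum.inl 0))) * h1
      · simp [Matrix.mulVec, dotProduct, m, hh, ← hF0, ← hF1]
        linear_combination (-h (f (Sum.inl 1))) * h1
    · simp [Matrix.mulVec, dotProduct, N, hh, ← hF0, ← hF1, Matrix.one_apply]
      linear_combination (-h (f (Sum.inr k))) * h1
  · rw [Matrix.det_fromBlocks_zero₁₂, hdet]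
    simp

/-- After an elementary operation, a unimodular column with monic first entry has an element of
the coefficient ring, outside a given maximal ideal, in the ideal of its first two entries. -/
theorem exists_notMem_maximal_mem_span {A κ : Type*} [CommRing A] [Fintype κ]
    (f : Fin 2 ⊕ κ → Polynomial A) (hf : UnimodularCol f) (hm : (f (Sum.inl 0)).Monic)
    (m : Ideal A) [hmax : m.IsMaximal] :
    ∃ (a : κ → Polynomial A) (c : A) (g₀ g₁ : Polynomial A), c ∉ m ∧
      g₀ * f (Sum.inl 0) + g₁ * (f (Sum.inl 1) + ∑ k, a k * f (Sum.inr k)) =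
        Polynomial.C c := by
  let _ := Ideal.Quotient.field m
  let φ : Polynomial A →+* Polynomial (A ⧸ m) := Polynomial.mapRingHom (Ideal.Quotient.mk m)
  have hφ : Function.Surjective φ := Polynomial.map_surjective _ Ideal.Quotient.mk_surjective
  have hm' : (φ (f (Sum.inl 0))).Monic := hm.map _
  let S := AdjoinRoot (φ (f (Sum.inl 0)))
  have : Module.Finite (A ⧸ m) S := hm'.finite_adjoinRoot
  have : IsArtinianRing S := IsArtinianRing.of_finite (A ⧸ m) S
  let π : Polynomial A →+* S := (AdjoinRoot.mk (φ (f (Sum.inl 0)))).comp φ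
  have hπ : Function.Surjective π := AdjoinRoot.mk_surjective.comp hφ
  have hπ0 : π (f (Sum.inl 0)) = 0 := AdjoinRoot.mk_self
  obtain ⟨w, hw⟩ := hf
  simp only [dotProduct, Fintype.sum_sum_type, Fin.sum_univ_two] at hw
  obtain ⟨a', ha'⟩ := exists_isUnit_add_sum (π (f (Sum.inl 1))) (fun k => π (f (Sum.inr k)))
    ⟨π (w (Sum.inl 1)), fun k => π (w (Sum.inr k)), by simpa [hπ0] using congrArg π hw⟩
  choose a ha using fun k => hπ (a' k)
  set f₁ := f (Sum.inl 1) + ∑ k, a k * f (Sum.inr k) with hf₁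
  have hu : IsUnit (π f₁) := by simpa [hf₁, ha] using ha'
  obtain ⟨y, hy⟩ := hu.exists_left_inv
  obtain ⟨g, rfl⟩ := hπ y
  have h1 : φ (f (Sum.inl 0)) ∣ φ (g * f₁ - 1) := by
    rw [← AdjoinRoot.mk_eq_zero]
    change π _ = 0
    simp [hy]
  obtain ⟨y, hy⟩ := h1
  obtain ⟨z, rfl⟩ := hφ y
  have h2 : g * f₁ - 1 - f (Sum.inl 0) * z ∈ m.map Polynomial.C := by
    rw [← Ideal.mk_ker (I := m), ← Polynomial.ker_mapRingHom, RingHom.mem_ker]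
    change φ _ = 0
    rw [map_sub, hy, map_mul, sub_self]
  let J : Ideal (Polynomial A) := Ideal.span {f (Sum.inl 0), f₁}
  have : Module.Finite A (Polynomial A ⧸ Ideal.span {f (Sum.inl 0)}) := hm.finite_adjoinRoot
  have hle : Ideal.span {f (Sum.inl 0)} ≤ J := Ideal.span_mono (by simp)
  have : Module.Finite A (Polynomial A ⧸ J) :=
    Module.Finite.of_surjective (Ideal.Quotient.factorₐ A hle).toLinearMap
      (Ideal.Quotient.factor_surjective hle)
  have hC : ∀ s : A, Ideal.Quotient.mk J (Polynomial.C s) = s • (1 : Polynomial A ⧸ J) := by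
    intro s
    change _ = Ideal.Quotient.mk J (s • 1)
    rw [Polynomial.smul_eq_C_mul, mul_one]
  obtain ⟨r, hr, hr'⟩ := Submodule.exists_sub_one_mem_and_smul_eq_zero_of_fg_of_le_smul m
    (⊤ : Submodule A (Polynomial A ⧸ J)) Module.Finite.fg_top (by
      intro x _
      obtain ⟨x, rfl⟩ := Ideal.Quotient.mk_surjective x
      have hx : x - (g * f₁ * x - f (Sum.inl 0) * z * x) ∈ m.map Polynomial.C := by
        have := Ideal.mul_mem_left _ (-x) h2
        convert this using 1
        ring
      have hxJ : g * f₁ * x - f (Sum.inl 0) * z * x ∈ J := by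
        refine sub_mem ?_ ?_
        · rw [mul_right_comm]
          exact Ideal.mul_mem_left _ _ (Ideal.subset_span (by simp))
        · rw [mul_assoc]
          exact Ideal.mul_mem_right _ _ (Ideal.subset_span (by simp))
      have hxe : Ideal.Quotient.mk J x =
          Ideal.Quotient.mk J (x - (g * f₁ * x - f (Sum.inl 0) * z * x)) := by
        rw [Ideal.Quotient.eq]
        simpa using hxJ
      rw [hxe]
      generalize x - (g * f₁ * x - f (Sum.inl 0) * z * x) = t at hx
      clear hxe hxJ
      induction hx using Submodule.span_induction with
      | mem t ht =>
        obtain ⟨s, hs, rfl⟩ := ht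
        rw [hC]
        exact Submodule.smul_mem_smul hs trivial
      | zero => simp
      | add a b _ _ ha hb => rw [map_add]; exact add_mem ha hb
      | smul p t _ ht =>
        rw [smul_eq_mul, map_mul]
        refine Submodule.smul_induction_on ht (fun s hs n _ => ?_) (fun a b ha hb => ?_)
        · rw [mul_smul_comm]
          exact Submodule.smul_mem_smul hs trivial
        · rw [mul_add]; exact add_mem ha hb)
  have hrJ : Polynomial.C r ∈ J := by
    rw [← Ideal.Quotient.eq_zero_iff_mem, hC]
    exact hr' 1 trivial
  obtain ⟨g₀, g₁, hgg⟩ := Ideal.mem_span_pair.1 hrJ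
  refine ⟨a, r, g₀, g₁, fun hrm => hmax.ne_top ((Ideal.eq_top_iff_one _).2 ?_), hgg⟩
  simpa using sub_mem hrm hr

/-- Adding multiples of other entries to the second entry does not change the orbit. -/
theorem colEquiv_add_sum {R κ : Type*} [CommRing R] [Fintype κ] [DecidableEq κ]
    (f : Fin 2 ⊕ κ → R) (a : κ → R) :
    ColEquiv f (Sum.elim ![f (Sum.inl 0), f (Sum.inl 1) + ∑ k, a k * f (Sum.inr k)]
      (f ∘ Sum.inr)) := by
  convert ColEquiv.of_isUnit_det (Matrix.fromBlocks 1 (Matrix.of ![0, a]) 0 1) ?_ f using 1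
  · ext i
    rcases i with i | k
    · fin_cases i <;> simp [Matrix.mulVec, dotProduct, Matrix.one_apply]
    · simp [Matrix.mulVec, dotProduct, Matrix.one_apply]
  · rw [Matrix.det_fromBlocks_zero₂₁]
    simp

/-- Suslin's theorem: a unimodular column over `A[X]` with a monic entry is equivalent to a
constant column. -/
theorem colEquiv_eval_zero_of_monic_inl {A κ : Type*} [CommRing A] [IsDomain A] [Fintype κ]
    [DecidableEq κ] (f : Fin 2 ⊕ κ → Polynomial A) (hf : UnimodularCol f)
    (hm : (f (Sum.inl 0)).Monic) :
    ColEquiv f (fun i => Polynomial.C ((f i).eval 0)) := by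
  let F : Fin 2 ⊕ κ → Polynomial (Polynomial A) := fun i => (f i).map Polynomial.C
  let J : Ideal A :=
    { carrier := {c | ∀ b x : Polynomial A,
        ColEquiv (fun i => (F i).eval b) (fun i => (F i).eval (b + Polynomial.C c * x))}
      add_mem' := by
        intro c d hc hd b x
        have h1 := (hc b x).trans (hd (b + Polynomial.C c * x) x)
        simpa [add_mul, add_assoc] using h1
      zero_mem' := by
        intro b x
        simpa using ColEquiv.rfl' _
      smul_mem' := by
        intro r c hc b x
        have := hc b (Polynomial.C r * x)
        rw [smul_eq_mul, Polynomial.C_mul, mul_comm (Polynomial.C r), mul_assoc]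
        exact this }
  have hJ : J = ⊤ := by
    by_contra hne
    obtain ⟨m, hmax, hle⟩ := J.exists_le_maximal hne
    obtain ⟨a, c, g₀, g₁, hcm, hg⟩ := exists_notMem_maximal_mem_span f hf hm m
    refine hcm (hle fun b x => ?_)
    have hc0 : Polynomial.C c ≠ 0 := by
      rw [Ne, Polynomial.C_eq_zero]
      rintro rfl
      exact hcm m.zero_mem
    have hF := colEquiv_add_sum F (fun k => (a k).map Polynomial.C)
    have h1 := colEquiv_eval_of_mem_span (g₀ := g₀.map Polynomial.C) (g₁ := g₁.map Polynomial.C)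
      (c := Polynomial.C c) (hc := hc0) (b := b) (x := x) (hg := by
        have := congrArg (Polynomial.map (Polynomial.C (R := A))) hg
        simpa [F, Polynomial.map_sum] using this)
      (f := Sum.elim ![F (Sum.inl 0), F (Sum.inl 1) + ∑ k, (a k).map Polynomial.C * F (Sum.inr k)]
        (F ∘ Sum.inr))
    have h2 := hF.map (Polynomial.evalRingHom b)
    have h3 := hF.map (Polynomial.evalRingHom (b + Polynomial.C c * x))
    exact (h2.trans h1).trans h3.symm
  have h1 : (1 : A) ∈ J := by rw [hJ]; trivial
  have := h1 0 Polynomial.X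
  have e1 : (fun i => (F i).eval (0 + Polynomial.C 1 * Polynomial.X)) = f := by
    ext1 i
    simp [F, Polynomial.eval_map, Polynomial.eval₂_C_X]
  have e2 : (fun i => (F i).eval (0 : Polynomial A)) =
      fun i => Polynomial.C ((f i).eval 0) := by
    ext1 i
    rw [← Polynomial.C_0, Polynomial.eval_map, Polynomial.eval₂_hom]
  rw [e1, e2] at this
  exact this.symm

/-- Suslin's theorem: a unimodular column over `A[X]` with a monic entry is equivalent to a
constant column. -/
theorem colEquiv_eval_zero_of_monic {A ι : Type*} [CommRing A] [IsDomain A] [Fintype ι]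
    [DecidableEq ι] (f : ι → Polynomial A) (hf : UnimodularCol f) (i : ι) (hm : (f i).Monic) :
    ColEquiv f (fun i => Polynomial.C ((f i).eval 0)) := by
  rcases subsingleton_or_nontrivial ι with hι | hι
  · have hu : IsUnit (f i) := by
      obtain ⟨w, hw⟩ := hf
      rw [dotProduct, Fintype.sum_subsingleton _ i] at hw
      exact IsUnit.of_mul_eq_one_right _ hw
    have h1 : f i = 1 := hm.eq_one_of_isUnit hu
    convert ColEquiv.rfl' f using 1
    ext1 j
    rw [Subsingleton.elim j i, h1]
    simp
  · obtain ⟨n, hn⟩ : ∃ n, Fintype.card ι = 2 + n :=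
      Nat.exists_eq_add_of_le (Fintype.one_lt_card (α := ι))
    let e : Fin 2 ⊕ Fin n ≃ ι := Fintype.equivOfCardEq (by simp [hn])
    let e' : Fin 2 ⊕ Fin n ≃ ι := e.trans (Equiv.swap (e (Sum.inl 0)) i)
    have he : e' (Sum.inl 0) = i := by simp [e']
    have h := colEquiv_eval_zero_of_monic_inl (f ∘ e') (hf.comp_equiv e')
      (by simpa [he] using hm)
    convert h.comp_equiv e'.symm using 1
    · ext1; simp
    · ext1; simp

namespace NoetherShear

section
open Polynomial List

variable {k : Type*} [Field k] {n : ℕ} (f : MvPolynomial (Fin (n + 1)) k)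
variable (v w : Fin (n + 1) →₀ ℕ)

variable {f v} in
lemma lt_up (vlt : ∀ i, v i < (2 + f.totalDegree)) : ∀ l ∈ ofFn v, l < (2 + f.totalDegree) := by
  grind

/-- We construct an algebra map `T1 f c` which maps `X_i` into `X_i + c • X_0 ^ r_i` when `i ≠ 0`
and `X_0` to `X_0`. -/
noncomputable abbrev T1 (c : k) :
    MvPolynomial (Fin (n + 1)) k →ₐ[k] MvPolynomial (Fin (n + 1)) k :=
  aeval fun i ↦ if i = 0 then X 0 else X i + c • X 0 ^ (2 + f.totalDegree) ^ (i : ℕ)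

lemma t1_comp_t1_neg (c : k) : (T1 f c).comp (T1 f (-c)) = AlgHom.id _ _ := by
  rw [comp_aeval, ← MvPolynomial.aeval_X_left]
  ext i v
  cases i using Fin.cases <;> simp

/-- `T1 f 1` leads to an algebra equiv `T f`. -/
noncomputable abbrev T := AlgEquiv.ofAlgHom (T1 f 1) (T1 f (-1))
  (t1_comp_t1_neg f 1) (by simpa using t1_comp_t1_neg f (-1))

lemma sum_r_mul_ne (vlt : ∀ i, v i < (2 + f.totalDegree)) (wlt : ∀ i, w i < (2 + f.totalDegree)) (ne : v ≠ w) :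
    ∑ x : Fin (n + 1), (2 + f.totalDegree) ^ (x : ℕ) * v x ≠ ∑ x : Fin (n + 1), (2 + f.totalDegree) ^ (x : ℕ) * w x := by
  intro h
  refine ne <| Finsupp.ext <| congrFun <| ofFn_inj.mp ?_
  apply Nat.ofDigits_inj_of_len_eq (Nat.lt_add_right f.totalDegree one_lt_two)
    (by simp) (lt_up vlt) (lt_up wlt)
  simpa only [Nat.ofDigits_eq_sum_mapIdx, mapIdx_eq_ofFn, get_ofFn, length_ofFn,
    Fin.val_cast, mul_comm, sum_ofFn] using! h

lemma degreeOf_zero_t {a : k} (ha : a ≠ 0) : ((T f) (monomial v a)).degreeOf 0 =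
    ∑ i : Fin (n + 1), ((2 + f.totalDegree) ^ (i : ℕ)) * v i := by
  rw [← natDegree_finSuccEquiv, monomial_eq, Finsupp.prod_pow v fun a ↦ X a]
  simp only [Fin.prod_univ_succ, Fin.sum_univ_succ, map_mul, map_prod, map_pow,
    AlgEquiv.ofAlgHom_apply, MvPolynomial.aeval_C, MvPolynomial.aeval_X, if_pos, Fin.succ_ne_zero,
    ite_false, one_smul, map_add, finSuccEquiv_X_zero, finSuccEquiv_X_succ, algebraMap_eq]
  have h (i : Fin n) :
      (Polynomial.C (X (R := k) i) + Polynomial.X ^ (2 + f.totalDegree) ^ (i.succ : ℕ)) ^ v i.succ ≠ 0 :=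
    pow_ne_zero (v i.succ) (leadingCoeff_ne_zero.mp <| by simp [add_comm, leadingCoeff_X_pow_add_C])
  rw [natDegree_mul (by simp [ha]) (mul_ne_zero (by simp) (Finset.prod_ne_zero_iff.mpr
    (fun i _ ↦ h i))), natDegree_mul (by simp) (Finset.prod_ne_zero_iff.mpr (fun i _ ↦ h i)),
    natDegree_prod _ _ (fun i _ ↦ h i), natDegree_finSuccEquiv, degreeOf_C]
  simpa only [natDegree_pow, zero_add, natDegree_X, mul_one, Fin.val_zero, pow_zero, one_mul,
    add_right_inj] using Finset.sum_congr rfl (fun i _ ↦ by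
    rw [add_comm (Polynomial.C _), natDegree_X_pow_add_C, mul_comm])

/-- `T` maps different monomials of `f` to polynomials with different degrees in `X_0`. -/
lemma degreeOf_t_ne_of_ne (hv : v ∈ f.support) (hw : w ∈ f.support) (ne : v ≠ w) :
    (T f <| monomial v <| coeff v f).degreeOf 0 ≠
    (T f <| monomial w <| coeff w f).degreeOf 0 := by
  rw [degreeOf_zero_t _ _ <| mem_support_iff.mp hv, degreeOf_zero_t _ _ <| mem_support_iff.mp hw]
  refine sum_r_mul_ne f v w (fun i ↦ ?_) (fun i ↦ ?_) ne <;>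
  exact lt_of_le_of_lt ((monomial_le_degreeOf i ‹_›).trans (degreeOf_le_totalDegree f i))
    (by lia)

lemma leadingCoeff_finSuccEquiv_t :
    (finSuccEquiv k n ((T f) ((monomial v) (coeff v f)))).leadingCoeff =
    algebraMap k _ (coeff v f) := by
  rw [monomial_eq, Finsupp.prod_fintype]
  · simp only [map_mul, map_prod, leadingCoeff_mul, leadingCoeff_prod]
    rw [AlgEquiv.ofAlgHom_apply, algHom_C, algebraMap_eq, finSuccEquiv_apply,
      eval₂Hom_C, RingHom.coe_comp]
    simp only [AlgEquiv.ofAlgHom_apply, Function.comp_apply, leadingCoeff_C, map_pow,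
      leadingCoeff_pow, algebraMap_eq]
    have : ∀ j, ((finSuccEquiv k n) ((T1 f) 1 (X j))).leadingCoeff = 1 := fun j ↦ by
      by_cases h : j = 0
      · simp [h, finSuccEquiv_apply]
      · simp only [aeval_eq_bind₁, bind₁_X_right, if_neg h, one_smul, map_add, map_pow]
        obtain ⟨i, rfl⟩ := Fin.exists_succ_eq.mpr h
        simp [finSuccEquiv_X_succ, finSuccEquiv_X_zero, add_comm]
    simp only [this, one_pow, Finset.prod_const_one, mul_one]
  exact fun i ↦ pow_zero _

/-- `T` maps `f` into some polynomial in `X_0` such that the leading coefficient is invertible. -/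
lemma T_leadingcoeff_isUnit (fne : f ≠ 0) :
    IsUnit (finSuccEquiv k n (T f f)).leadingCoeff := by
  obtain ⟨v, vin, vs⟩ := Finset.exists_max_image f.support
    (fun v ↦ (T f ((monomial v) (coeff v f))).degreeOf 0) (support_nonempty.mpr fne)
  set h := fun w ↦ (MvPolynomial.monomial w) (coeff w f)
  simp only [← natDegree_finSuccEquiv] at vs
  replace vs : ∀ x ∈ f.support \ {v}, (finSuccEquiv k n ((T f) (h x))).degree <
      (finSuccEquiv k n ((T f) (h v))).degree := by
    intro x hx
    obtain ⟨h1, h2⟩ := Finset.mem_sdiff.mp hx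
    apply degree_lt_degree <| lt_of_le_of_ne (vs x h1) ?_
    simpa only [natDegree_finSuccEquiv]
      using degreeOf_t_ne_of_ne f _ _ h1 vin <| ne_of_not_mem_cons h2
  have coeff : (finSuccEquiv k n ((T f) (h v + ∑ x ∈ f.support \ {v}, h x))).leadingCoeff =
      (finSuccEquiv k n ((T f) (h v))).leadingCoeff := by
    simp only [map_add, map_sum]
    rw [add_comm]
    apply leadingCoeff_add_of_degree_lt <| (lt_of_le_of_lt <| degree_sum_le _ _) ?_
    have h2 : h v ≠ 0 := by simpa [h] using mem_support_iff.mp vin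
    replace h2 : (finSuccEquiv k n ((T f) (h v))) ≠ 0 := fun eq ↦ h2 <|
      by simpa only [map_eq_zero_iff _ (AlgEquiv.injective _)] using eq
    exact (Finset.sup_lt_iff <| Ne.bot_lt (fun x ↦ h2 <| degree_eq_bot.mp x)).mpr vs
  nth_rw 2 [← f.support_sum_monomial_coeff]
  rw [Finset.sum_eq_add_sum_sdiff_singleton_of_mem vin h]
  rw [leadingCoeff_finSuccEquiv_t] at coeff
  simpa only [coeff, algebraMap_eq] using (mem_support_iff.mp vin).isUnit.map MvPolynomial.C

end

end NoetherShear

/-- Every unimodular column over a polynomial ring over a field is equivalent to a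
coordinate vector. -/
theorem UnimodularCol.colEquiv_single {K : Type*} [Field K] (n : ℕ) {ι : Type*} [Fintype ι]
    [DecidableEq ι] (v : ι → MvPolynomial (Fin n) K) (hv : UnimodularCol v) (j : ι) :
    ColEquiv v (Pi.single j 1) := by
  have hne : ∃ i, v i ≠ 0 := by
    by_contra! h
    obtain ⟨w, hw⟩ := hv
    simp [dotProduct, h] at hw
  obtain ⟨i, hi⟩ := hne
  induction n generalizing ι with
  | zero =>
    refine ColEquiv.of_isUnit_apply v i ?_ j
    have : IsUnit (isEmptyRingEquiv K (Fin 0) (v i)) := by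
      rw [isUnit_iff_ne_zero]
      exact (map_ne_zero_iff _ (RingEquiv.injective _)).2 hi
    have := this.map (isEmptyRingEquiv K (Fin 0)).symm
    rwa [RingEquiv.symm_apply_apply] at this
  | succ n ih =>
    obtain ⟨e, u, hu⟩ : ∃ e : MvPolynomial (Fin (n + 1)) K ≃+* Polynomial (MvPolynomial (Fin n) K),
        IsUnit (e (v i)).leadingCoeff :=
      ⟨(NoetherShear.T (v i)).toRingEquiv.trans (finSuccEquiv K n).toRingEquiv,
        NoetherShear.T_leadingcoeff_isUnit (v i) hi⟩
    let g : ι → Polynomial (MvPolynomial (Fin n) K) :=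
      fun k => Polynomial.C (↑u⁻¹ : MvPolynomial (Fin n) K) * e (v k)
    have hvg : ColEquiv (e ∘ v) g := by
      refine ColEquiv.of_isUnit_det
        (Polynomial.C (↑u⁻¹ : MvPolynomial (Fin n) K) • (1 : Matrix ι ι _)) ?_ (e ∘ v) |>.trans ?_
      · rw [Matrix.det_smul, Matrix.det_one, mul_one]
        exact ((u⁻¹).isUnit.map Polynomial.C).pow _
      · convert ColEquiv.rfl' g using 1
        ext1 k
        simp [g, Matrix.smul_mulVec]
    have hev : UnimodularCol (e ∘ v) := by
      obtain ⟨w, hw⟩ := hv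
      refine ⟨e ∘ w, ?_⟩
      rw [← map_one e, ← hw]
      simp [dotProduct]
    have hgu : UnimodularCol g := hvg.unimodularCol hev
    have hm : (g i).Monic := by
      rw [Polynomial.Monic, Polynomial.leadingCoeff_mul, Polynomial.leadingCoeff_C, ← hu]
      simp
    have h1 := colEquiv_eval_zero_of_monic g hgu i hm
    have hcu : UnimodularCol (fun k => (g k).eval 0) := by
      obtain ⟨w, hw⟩ := hgu
      refine ⟨fun k => (w k).eval 0, ?_⟩
      rw [← Polynomial.eval_one (x := (0 : MvPolynomial (Fin n) K)), ← hw]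
      simp only [dotProduct, Polynomial.eval_finsetSum, Polynomial.eval_mul]
    have hne : ∃ i, (g i).eval 0 ≠ 0 := by
      by_contra! h
      obtain ⟨w, hw⟩ := hcu
      simp [dotProduct, h] at hw
    obtain ⟨i', hi'⟩ := hne
    have h2 := (ih _ hcu j i' hi').map (Polynomial.C (R := MvPolynomial (Fin n) K))
    have h3 := ((hvg.trans h1).trans h2).map e.symm.toRingHom
    convert h3 using 1
    · ext1 k; simp
    · ext1 k
      by_cases hk : k = j
      · subst hk; simp
      · simp [hk]

/-- Every idempotent matrix over `R` is a product `U * V` with `V * U = 1`; equivalently, every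
finitely generated projective module over `R` is free. -/
def IdempotentsSplit (R : Type*) [CommRing R] : Prop :=
  ∀ (l : ℕ) (e : Matrix (Fin l) (Fin l) R), e * e = e →
    ∃ (r : ℕ) (U : Matrix (Fin l) (Fin r) R) (V : Matrix (Fin r) (Fin l) R),
      U * V = e ∧ V * U = 1

/-- Unimodular columns over `R` of positive length are equivalent to the first basis vector. -/
def ColumnsCompletable (R : Type*) [CommRing R] : Prop :=
  ∀ (l : ℕ) (v : Fin (l + 1) → R), UnimodularCol v → ColEquiv v (Pi.single 0 1)

theorem IdempotentsSplit.of_ringEquiv {R S : Type*} [CommRing R] [CommRing S] (φ : R ≃+* S)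
    (h : IdempotentsSplit R) : IdempotentsSplit S := by
  intro l e he
  obtain ⟨r, U, V, h1, h2⟩ := h l (e.map φ.symm) (by
    rw [← RingEquiv.coe_toRingHom, ← Matrix.map_mul, he])
  refine ⟨r, U.map φ, V.map φ, ?_, ?_⟩
  · rw [← RingEquiv.coe_toRingHom, ← Matrix.map_mul, h1]
    ext i j
    simp
  · rw [← RingEquiv.coe_toRingHom, ← Matrix.map_mul, h2]
    exact Matrix.map_one _ (map_zero _) (map_one _)

/-- An idempotent endomorphism factoring through a finite free module has free range. -/
theorem IdempotentsSplit.exists_linearMap {A : Type*} [CommRing A] (hA : IdempotentsSplit A)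
    {ι M : Type*} [Fintype ι] [AddCommGroup M] [Module A M] (π : M →ₗ[A] M) (hπ : π ∘ₗ π = π)
    (s : (ι → A) →ₗ[A] M) (p : M →ₗ[A] (ι → A)) (hsp : s ∘ₗ p = π) :
    ∃ (r : ℕ) (i : (Fin r → A) →ₗ[A] M) (k : M →ₗ[A] (Fin r → A)),
      k ∘ₗ i = LinearMap.id ∧ i ∘ₗ k = π := by
  let φ : (ι → A) ≃ₗ[A] (Fin (Fintype.card ι) → A) :=
    LinearEquiv.funCongrLeft A A (Fintype.equivFin ι).symm
  let s' : (Fin (Fintype.card ι) → A) →ₗ[A] M := s ∘ₗ φ.symm.toLinearMap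
  let p' : M →ₗ[A] (Fin (Fintype.card ι) → A) := φ.toLinearMap ∘ₗ p
  have hsp' : ∀ x, s' (p' x) = π x := by
    intro x
    simp [s', p', ← hsp]
  have hπ' : ∀ x, π (π x) = π x := fun x => LinearMap.congr_fun hπ x
  obtain ⟨r, U, V, h1, h2⟩ := hA _ (LinearMap.toMatrix' (p' ∘ₗ π ∘ₗ s')) (by
    rw [← LinearMap.toMatrix'_comp]
    congr 1
    refine LinearMap.ext fun x => ?_
    simp [hsp', hπ'])
  have hUV : ∀ x, U.mulVecLin (V.mulVecLin x) = p' (π (s' x)) := by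
    intro x
    have := congrArg (fun N => N *ᵥ x) h1
    simpa [LinearMap.toMatrix'_mulVec, ← Matrix.mulVec_mulVec] using this
  have hVU : ∀ x, V.mulVecLin (U.mulVecLin x) = x := by
    intro x
    have := congrArg (fun N => N *ᵥ x) h2
    simpa [← Matrix.mulVec_mulVec] using this
  refine ⟨r, π ∘ₗ s' ∘ₗ U.mulVecLin, V.mulVecLin ∘ₗ p' ∘ₗ π, ?_, ?_⟩
  · refine LinearMap.ext fun x => ?_
    simp only [LinearMap.comp_apply, hπ', ← hUV, hVU, LinearMap.id_apply]
  · refine LinearMap.ext fun x => ?_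
    simp only [LinearMap.comp_apply, hsp', hπ', hUV]

/-- A stably free module is free when unimodular columns are completable, in terms of matrices. -/
theorem exists_split_of_stablyFree {R : Type*} [CommRing R] (hcol : ColumnsCompletable R)
    {l : ℕ} (e : Matrix (Fin l) (Fin l) R) (s : ℕ) {N : ℕ} (Φ : Matrix (Fin l) (Fin N) R)
    (S : Matrix (Fin N) (Fin l) R) (Ψ : Matrix (Fin N) (Fin s) R) (W : Matrix (Fin s) (Fin N) R)
    (h1 : Φ * S = e) (h2 : S * Φ + Ψ * W = 1) (h3 : W * Ψ = 1) (h4 : Φ * Ψ = 0) :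
    ∃ (r : ℕ) (U : Matrix (Fin l) (Fin r) R) (V : Matrix (Fin r) (Fin l) R),
      U * V = e ∧ V * U = 1 := by
  induction s generalizing N with
  | zero =>
    refine ⟨N, Φ, S, h1, ?_⟩
    rw [← h2, left_eq_add]
    ext i j
    simp [Matrix.mul_apply]
  | succ s ih =>
    rcases subsingleton_or_nontrivial R with hR | hR
    · exact ⟨0, 0, 0, Subsingleton.elim _ _, Subsingleton.elim _ _⟩
    cases N with
    | zero =>
      have := congrFun (congrFun h3 0) 0
      simp [Matrix.mul_apply] at this
    | succ N =>
      obtain ⟨G, hG⟩ := hcol N (fun i => Ψ i 0) ⟨fun i => W 0 i, by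
        have := congrFun (congrFun h3 0) 0
        simpa [Matrix.mul_apply, dotProduct] using this⟩
      obtain ⟨Φ', hΦ'⟩ : ∃ X, X = Φ * (↑G⁻¹ : Matrix (Fin (N + 1)) (Fin (N + 1)) R) := ⟨_, rfl⟩
      obtain ⟨S', hS'⟩ : ∃ X, X = (G : Matrix (Fin (N + 1)) (Fin (N + 1)) R) * S := ⟨_, rfl⟩
      obtain ⟨Ψ', hΨ'⟩ : ∃ X, X = (G : Matrix (Fin (N + 1)) (Fin (N + 1)) R) * Ψ := ⟨_, rfl⟩
      obtain ⟨W', hW'⟩ : ∃ X, X = W * (↑G⁻¹ : Matrix (Fin (N + 1)) (Fin (N + 1)) R) := ⟨_, rfl⟩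
      have k1 : Φ' * S' = e := by
        rw [hΦ', hS', Matrix.mul_assoc, ← Matrix.mul_assoc _ _ S, Units.inv_mul, Matrix.one_mul, h1]
      have k3 : W' * Ψ' = 1 := by
        rw [hW', hΨ', Matrix.mul_assoc, ← Matrix.mul_assoc _ _ Ψ, Units.inv_mul, Matrix.one_mul, h3]
      have k4 : Φ' * Ψ' = 0 := by
        rw [hΦ', hΨ', Matrix.mul_assoc, ← Matrix.mul_assoc _ _ Ψ, Units.inv_mul, Matrix.one_mul, h4]
      have k2 : S' * Φ' + Ψ' * W' = 1 := by
        have : S' * Φ' + Ψ' * W' =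
            (G : Matrix (Fin (N + 1)) (Fin (N + 1)) R) * (S * Φ + Ψ * W) *
              (↑G⁻¹ : Matrix (Fin (N + 1)) (Fin (N + 1)) R) := by
          rw [hS', hΦ', hΨ', hW', Matrix.mul_add, Matrix.add_mul]
          simp only [Matrix.mul_assoc]
        rw [this, h2, Matrix.mul_one, Units.mul_inv]
      have hcolΨ : ∀ i, Ψ' i 0 = (Pi.single 0 1 : Fin (N + 1) → R) i := by
        intro i
        rw [← hG, hΨ']
        rfl
      have hΨ0 : Ψ' 0 0 = 1 := by simp [hcolΨ]
      have hΨs : ∀ i : Fin N, Ψ' i.succ 0 = 0 := by simp [hcolΨ]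
      have hΦ0 : ∀ i, Φ' i 0 = 0 := by
        intro i
        have := congrFun (congrFun k4 i) 0
        simpa [Matrix.mul_apply, Fin.sum_univ_succ, hΨ0, hΨs] using this
      have hW0 : ∀ i : Fin s, W' i.succ 0 = 0 := by
        intro i
        have := congrFun (congrFun k3 i.succ) 0
        simpa [Matrix.mul_apply, Fin.sum_univ_succ, hΨ0, hΨs] using this
      refine ih (Φ'.submatrix id Fin.succ) (S'.submatrix Fin.succ id)
        (Ψ'.submatrix Fin.succ Fin.succ) (W'.submatrix Fin.succ Fin.succ) ?_ ?_ ?_ ?_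
      · ext i j
        have := congrFun (congrFun k1 i) j
        simpa [Matrix.mul_apply, Fin.sum_univ_succ, hΦ0] using this
      · ext i j
        have := congrFun (congrFun k2 i.succ) j.succ
        simpa [Matrix.mul_apply, Fin.sum_univ_succ (n := s), hΨs, Matrix.one_apply] using this
      · ext i j
        have := congrFun (congrFun k3 i.succ) j.succ
        simpa [Matrix.mul_apply, Fin.sum_univ_succ (n := N), hW0, Matrix.one_apply] using this
      · ext i j
        have := congrFun (congrFun k4 i) j.succ
        simpa [Matrix.mul_apply, Fin.sum_univ_succ (n := N), hΦ0] using this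

/-- Division by a monic polynomial as a linear map. -/
noncomputable def divByMonicLinear {A : Type*} [CommRing A] {f : Polynomial A} (hf : f.Monic) :
    Polynomial A →ₗ[A] Polynomial A where
  toFun p := p /ₘ f
  map_add' p q := by
    nontriviality A
    refine (Polynomial.div_modByMonic_unique (r := p %ₘ f + q %ₘ f) _ hf ⟨?_, ?_⟩).1
    · linear_combination Polynomial.modByMonic_add_div p f + Polynomial.modByMonic_add_div q f
    · exact (Polynomial.degree_add_le _ _).trans_lt
        (max_lt (Polynomial.degree_modByMonic_lt p hf) (Polynomial.degree_modByMonic_lt q hf))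
  map_smul' c p := by
    nontriviality A
    refine (Polynomial.div_modByMonic_unique (r := c • (p %ₘ f)) _ hf ⟨?_, ?_⟩).1
    · rw [RingHom.id_apply, mul_smul_comm, ← smul_add, Polynomial.modByMonic_add_div]
    · exact (Polynomial.degree_smul_le _ _).trans_lt (Polynomial.degree_modByMonic_lt p hf)

@[simp] theorem divByMonicLinear_mul {A : Type*} [CommRing A] {f : Polynomial A} (hf : f.Monic)
    (p : Polynomial A) : divByMonicLinear hf (f * p) = p :=
  Polynomial.mul_divByMonic_cancel_left p hf

/-- Division with remainder by the characteristic matrix of a square matrix. -/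
theorem exists_eq_C_add_charmatrix_mulVec {A ι : Type*} [CommRing A] [Fintype ι] [DecidableEq ι]
    (τ : Matrix ι ι A) (x : ι → Polynomial A) :
    ∃ (x₀ : ι → A) (y : ι → Polynomial A),
      x = (fun i => Polynomial.C (x₀ i)) + charmatrix τ *ᵥ y := by
  let L : Submodule (Polynomial A) (ι → Polynomial A) :=
    { carrier := {x | ∃ (x₀ : ι → A) (y : ι → Polynomial A),
        x = (fun i => Polynomial.C (x₀ i)) + charmatrix τ *ᵥ y}
      add_mem' := by
        rintro _ _ ⟨x₀, y, rfl⟩ ⟨x₁, z, rfl⟩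
        refine ⟨x₀ + x₁, y + z, ?_⟩
        rw [Matrix.mulVec_add]
        ext1 i
        simp only [Pi.add_apply, Polynomial.C_add]
        ring
      zero_mem' := ⟨0, 0, by ext1; simp⟩
      smul_mem' := by
        rintro p _ ⟨x₀, y, rfl⟩
        induction p using Polynomial.induction_on' generalizing x₀ y with
        | add p q hp hq =>
          obtain ⟨x₁, y₁, h₁⟩ := hp x₀ y
          obtain ⟨x₂, y₂, h₂⟩ := hq x₀ y
          refine ⟨x₁ + x₂, y₁ + y₂, ?_⟩
          rw [add_smul, h₁, h₂, Matrix.mulVec_add]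
          ext1 i
          simp only [Pi.add_apply, Polynomial.C_add]
          ring
        | monomial n a =>
          induction n generalizing x₀ y with
          | zero =>
            refine ⟨a • x₀, Polynomial.C a • y, ?_⟩
            rw [Polynomial.monomial_zero_left, smul_add, Matrix.mulVec_smul]
            ext1 i
            simp
          | succ n ih =>
            obtain ⟨x₁, y₁, h₁⟩ := ih (τ *ᵥ x₀)
              ((Polynomial.X : Polynomial A) • y + fun i => Polynomial.C (x₀ i))
            refine ⟨x₁, y₁, ?_⟩
            rw [← h₁, ← Polynomial.monomial_mul_X, mul_smul]
            congr 1
            have hc : charmatrix τ *ᵥ (fun i => Polynomial.C (x₀ i)) =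
                (Polynomial.X : Polynomial A) • (fun i => Polynomial.C (x₀ i)) -
                  fun i => Polynomial.C ((τ *ᵥ x₀) i) := by
              rw [charmatrix, Matrix.sub_mulVec]
              congr 1
              · ext1 i
                simp [Matrix.mulVec_diagonal]
              · ext1 i
                simp [Matrix.mulVec, dotProduct]
            rw [Matrix.mulVec_add, Matrix.mulVec_smul, smul_add, hc]
            abel }
  have hx : x = ∑ j, x j • fun i => Polynomial.C ((Pi.single j (1 : A) : ι → A) i) := by
    ext1 i
    simp [Pi.single_apply]
  rw [hx]
  exact L.sum_mem fun j _ => L.smul_mem _ ⟨Pi.single j 1, 0, by simp⟩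

theorem charmatrix_mulVec_injective {A ι : Type*} [CommRing A] [IsDomain A] [Fintype ι]
    [DecidableEq ι] (τ : Matrix ι ι A) {y : ι → Polynomial A} (h : charmatrix τ *ᵥ y = 0) :
    y = 0 :=
  Matrix.eq_zero_of_mulVec_eq_zero (Matrix.charpoly_monic τ).ne_zero h

theorem exists_split_of_stablyFree' {R : Type*} [CommRing R] (hcol : ColumnsCompletable R)
    {l s : ℕ} (e : Matrix (Fin l) (Fin l) R) {ν : Type*} [Fintype ν] [DecidableEq ν]
    (Φ : Matrix (Fin l) ν R) (S : Matrix ν (Fin l) R) (Ψ : Matrix ν (Fin s) R)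
    (W : Matrix (Fin s) ν R)
    (h1 : Φ * S = e) (h2 : S * Φ + Ψ * W = 1) (h3 : W * Ψ = 1) (h4 : Φ * Ψ = 0) :
    ∃ (r : ℕ) (U : Matrix (Fin l) (Fin r) R) (V : Matrix (Fin r) (Fin l) R),
      U * V = e ∧ V * U = 1 := by
  let g := (Fintype.equivFin ν).symm
  refine exists_split_of_stablyFree hcol e s (Φ.submatrix id g) (S.submatrix g id)
    (Ψ.submatrix g id) (W.submatrix id g) ?_ ?_ ?_ ?_
  · rw [Matrix.submatrix_mul_equiv, h1, Matrix.submatrix_id_id]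
  · rw [← Matrix.submatrix_mul _ _ g id g Function.bijective_id,
      ← Matrix.submatrix_mul _ _ g id g Function.bijective_id]
    refine Eq.trans ?_ ((congrArg (fun P => P.submatrix g g) h2).trans
      (Matrix.submatrix_one_equiv g))
    rfl
  · rw [Matrix.submatrix_mul_equiv, h3, Matrix.submatrix_id_id]
  · rw [Matrix.submatrix_mul_equiv, h4]
    rfl

/-- The cokernel of an injective matrix is free if it is isomorphic to the range of an
idempotent matrix. -/
theorem exists_split_of_exact {R : Type*} [CommRing R] (hcol : ColumnsCompletable R)
    {l s : ℕ} (e : Matrix (Fin l) (Fin l) R) {ν : Type*} [Fintype ν] [DecidableEq ν]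
    (Φ : Matrix (Fin l) ν R) (S : Matrix ν (Fin l) R) (Ψ : Matrix ν (Fin s) R)
    (hΦS : Φ * S = e) (heΦ : e * Φ = Φ) (hΦΨ : Φ * Ψ = 0)
    (hker : ∀ z, Φ *ᵥ z = 0 → ∃ y, z = Ψ *ᵥ y) (hinj : ∀ y, Ψ *ᵥ y = 0 → y = 0) :
    ∃ (r : ℕ) (U : Matrix (Fin l) (Fin r) R) (V : Matrix (Fin r) (Fin l) R),
      U * V = e ∧ V * U = 1 := by
  have hZ : Φ * (1 - S * Φ) = 0 := by
    rw [Matrix.mul_sub, ← Matrix.mul_assoc Φ, hΦS, heΦ, Matrix.mul_one, sub_self]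
  have hZ' : ∀ j, Φ *ᵥ (1 - S * Φ).col j = 0 := fun j => congrFun (congrArg Matrix.col hZ) j
  choose w hw using fun j => hker _ (hZ' j)
  let W : Matrix (Fin s) (ν) (R) := Matrix.of fun a j => w j a
  have hΨW : Ψ * W = 1 - S * Φ := Matrix.ext_col fun j => (hw j).symm
  refine exists_split_of_stablyFree' hcol e Φ (S) Ψ W hΦS ?_ ?_ hΦΨ
  · rw [hΨW, add_sub_cancel]
  · rw [← sub_eq_zero]
    have h0 : Ψ * (W * Ψ - 1) = 0 := by
      rw [Matrix.mul_sub, ← Matrix.mul_assoc, hΨW, Matrix.sub_mul, Matrix.mul_assoc _ Φ, hΦΨ]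
      simp
    refine Matrix.ext_col fun j => ?_
    exact hinj _ (congrFun (congrArg Matrix.col h0) j)

/-- The projection of `A[X]^l` onto its remainders modulo a monic polynomial factors through a
finite free module. -/
theorem exists_linearMap_sub_smul_divByMonic {A : Type*} [CommRing A] [Nontrivial A]
    {f : Polynomial A} (hf : f.Monic) {l : ℕ} :
    ∃ (s : (Fin l × Fin f.natDegree → A) →ₗ[A] (Fin l → Polynomial A))
      (p : (Fin l → Polynomial A) →ₗ[A] (Fin l × Fin f.natDegree → A)),
      ∀ x, s (p x) = x - f • fun i => x i /ₘ f := by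
  refine ⟨LinearMap.pi fun i => ∑ k : Fin f.natDegree,
      Polynomial.monomial (k : ℕ) ∘ₗ LinearMap.proj (i, k),
    LinearMap.pi fun ik => Polynomial.lcoeff A (ik.2 : ℕ) ∘ₗ Polynomial.modByMonicHom f ∘ₗ
      LinearMap.proj ik.1, fun x => ?_⟩
  ext1 i
  have h := Polynomial.sum_fin (fun k a => Polynomial.monomial k a) (by simp)
    (n := f.natDegree) (p := x i %ₘ f)
    (by simpa [Polynomial.degree_eq_natDegree hf.ne_zero] using
      Polynomial.degree_modByMonic_lt (x i) hf)
  rw [Polynomial.sum_monomial_eq] at h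
  simp only [LinearMap.pi_apply, LinearMap.sum_apply, LinearMap.comp_apply,
    LinearMap.proj_apply, Polynomial.lcoeff_apply, Polynomial.modByMonicHom_apply, h,
    Pi.sub_apply, Pi.smul_apply, smul_eq_mul]
  linear_combination Polynomial.modByMonic_add_div (x i) f

/-- The finite free module attached to an idempotent matrix over `A[X]` which splits up to a
monic factor. -/
theorem exists_linearMap_of_monic {A : Type*} [CommRing A] [IsDomain A] (hA : IdempotentsSplit A)
    {l r : ℕ}
    (e : Matrix (Fin l) (Fin l) (Polynomial A)) (he : e * e = e) {f : Polynomial A}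
    (hf : f.Monic) (U : Matrix (Fin l) (Fin r) (Polynomial A))
    (V : Matrix (Fin r) (Fin l) (Polynomial A)) (hUV : U * V = f • e)
    (hVU : V * U = f • 1) (heU : e * U = U) (hVe : V * e = V) :
    ∃ (s : ℕ) (i : (Fin s → A) →ₗ[A] (Fin l → Polynomial A))
      (k : (Fin l → Polynomial A) →ₗ[A] (Fin s → A))
      (dv : (Fin r → Polynomial A) →ₗ[A] (Fin r → Polynomial A)),
      (∀ a, k (i a) = a) ∧ (∀ x, i (k x) = e *ᵥ x - U *ᵥ dv (V *ᵥ x)) ∧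
      (∀ a, e *ᵥ i a = i a) ∧ (∀ w, k (U *ᵥ w) = 0) := by
  let dv : (Fin r → Polynomial A) →ₗ[A] (Fin r → Polynomial A) :=
    (divByMonicLinear hf).compLeft (Fin r)
  have hdv : ∀ w, dv (f • w) = w := by
    intro w
    ext1 i
    simp [dv]
  let π : (Fin l → Polynomial A) →ₗ[A] (Fin l → Polynomial A) :=
    e.mulVecLin.restrictScalars A -
      U.mulVecLin.restrictScalars A ∘ₗ dv ∘ₗ V.mulVecLin.restrictScalars A
  have hπ : ∀ x, π x = e *ᵥ x - U *ᵥ dv (V *ᵥ x) := fun x => rfl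
  have hee : ∀ x, e *ᵥ (e *ᵥ x) = e *ᵥ x := fun x => by rw [Matrix.mulVec_mulVec, he]
  have heU' : ∀ x, e *ᵥ (U *ᵥ x) = U *ᵥ x := fun x => by rw [Matrix.mulVec_mulVec, heU]
  have hVe' : ∀ x, V *ᵥ (e *ᵥ x) = V *ᵥ x := fun x => by rw [Matrix.mulVec_mulVec, hVe]
  have hUV' : ∀ x, U *ᵥ (V *ᵥ x) = f • (e *ᵥ x) := fun x => by
    rw [Matrix.mulVec_mulVec, hUV, Matrix.smul_mulVec]
  have hVU' : ∀ x, V *ᵥ (U *ᵥ x) = f • x := fun x => by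
    rw [Matrix.mulVec_mulVec, hVU, Matrix.smul_mulVec, Matrix.one_mulVec]
  have hπU : ∀ w, π (U *ᵥ w) = 0 := by
    intro w
    rw [hπ, heU', hVU', hdv, sub_self]
  have heπ : ∀ x, e *ᵥ π x = π x := by
    intro x
    rw [hπ, Matrix.mulVec_sub, hee, heU']
  have hππ : ∀ x, π (π x) = π x := by
    intro x
    rw [hπ (π x), heπ, hπ x, Matrix.mulVec_sub, hVe', hVU', map_sub, hdv, sub_self,
      Matrix.mulVec_zero, sub_zero]
  have hπf : ∀ x, π (f • x) = 0 := by
    intro x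
    rw [hπ, Matrix.mulVec_smul, Matrix.mulVec_smul, hdv, hUV', sub_self]
  obtain ⟨s₀, p₀, hsp⟩ := exists_linearMap_sub_smul_divByMonic hf (l := l)
  obtain ⟨s, i, k, hki, hik⟩ := hA.exists_linearMap π (LinearMap.ext hππ) (π ∘ₗ s₀) p₀ (by
    refine LinearMap.ext fun x => ?_
    rw [LinearMap.comp_apply, LinearMap.comp_apply, hsp, map_sub, hπf, sub_zero])
  replace hki : ∀ a, k (i a) = a := fun a => LinearMap.congr_fun hki a
  replace hik : ∀ x, i (k x) = π x := fun x => LinearMap.congr_fun hik x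
  have hπi : ∀ a, π (i a) = i a := fun a => by rw [← hik, hki]
  have hei : ∀ a, e *ᵥ i a = i a := fun a => by rw [← hπi, heπ]
  have hkU : ∀ w, k (U *ᵥ w) = 0 := fun w => by rw [← hki (k _), hik, hπU, map_zero]
  exact ⟨s, i, k, dv, hki, fun x => (hik x).trans (hπ x), hei, hkU⟩

/-- An idempotent matrix over `A[X]` which splits up to a monic factor splits. -/
theorem exists_split_of_monic {A : Type*} [CommRing A] [IsDomain A] (hA : IdempotentsSplit A)
    (hcol : ColumnsCompletable (Polynomial A)) {l r : ℕ}
    (e : Matrix (Fin l) (Fin l) (Polynomial A)) (he : e * e = e) {f : Polynomial A}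
    (hf : f.Monic) (U : Matrix (Fin l) (Fin r) (Polynomial A))
    (V : Matrix (Fin r) (Fin l) (Polynomial A)) (hUV : U * V = f • e)
    (hVU : V * U = f • 1) (heU : e * U = U) (hVe : V * e = V) :
    ∃ (r : ℕ) (U : Matrix (Fin l) (Fin r) (Polynomial A))
      (V : Matrix (Fin r) (Fin l) (Polynomial A)), U * V = e ∧ V * U = 1 := by
  obtain ⟨s, i, k, dv, hki, hik, hei, hkU⟩ :=
    exists_linearMap_of_monic hA e he hf U V hUV hVU heU hVe
  have hVU' : ∀ x, V *ᵥ (U *ᵥ x) = f • x := fun x => by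
    rw [Matrix.mulVec_mulVec, hVU, Matrix.smul_mulVec, Matrix.one_mulVec]
  let I : Matrix (Fin l) (Fin s) (Polynomial A) := Matrix.of fun a j => i (Pi.single j 1) a
  have hI : ∀ a : Fin s → A, (I *ᵥ fun j => Polynomial.C (a j)) = i a := by
    intro a
    have : a = ∑ j, a j • Pi.single j (1 : A) := by
      ext1 b
      simp [Pi.single_apply]
    conv_rhs => rw [this, map_sum]
    ext1 b
    simp [I, Matrix.mulVec, dotProduct, Polynomial.smul_eq_C_mul, mul_comm]
  let Λ : Matrix (Fin r) (Fin s) (Polynomial A) :=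
    Matrix.of fun a j => dv (V *ᵥ ((Polynomial.X : Polynomial A) • i (Pi.single j 1))) a
  let τ : Matrix (Fin s) (Fin s) A :=
    Matrix.of fun a j => k ((Polynomial.X : Polynomial A) • i (Pi.single j 1)) a
  have hIτ : I * charmatrix τ = U * Λ := by
    refine Matrix.ext_col fun j => ?_
    have e1 : (I * charmatrix τ).col j =
        (Polynomial.X : Polynomial A) • i (Pi.single j 1) -
          i (k ((Polynomial.X : Polynomial A) • i (Pi.single j 1))) := by
      have e0 : (Polynomial.X : Polynomial A) • i (Pi.single j 1) -
          i (k ((Polynomial.X : Polynomial A) • i (Pi.single j 1))) =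
          I *ᵥ (((Polynomial.X : Polynomial A) •
            fun b => Polynomial.C ((Pi.single j 1 : Fin s → A) b)) -
            fun b => Polynomial.C (τ b j)) := by
        rw [Matrix.mulVec_sub, Matrix.mulVec_smul, hI, hI fun b => τ b j]
        rfl
      rw [e0]
      ext1 b
      simp only [Matrix.col_apply, Matrix.mul_apply, Matrix.mulVec, dotProduct]
      refine Finset.sum_congr rfl fun c _ => ?_
      congr 1
      by_cases hcj : c = j
      · subst hcj
        simp
      · simp [hcj]
    have e2 : (U * Λ).col j =
        U *ᵥ dv (V *ᵥ ((Polynomial.X : Polynomial A) • i (Pi.single j 1))) := rfl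
    rw [e1, e2, hik, Matrix.mulVec_smul e, hei]
    abel
  let Φ : Matrix (Fin l) (Fin s ⊕ Fin r) (Polynomial A) := Matrix.fromCols I U
  let Ψ : Matrix (Fin s ⊕ Fin r) (Fin s) (Polynomial A) := Matrix.fromRows (charmatrix τ) (-Λ)
  have hΦΨ : Φ * Ψ = 0 := by
    rw [Matrix.fromCols_mul_fromRows, hIτ, Matrix.mul_neg, add_neg_cancel]
  have heI : e * I = I := by
    refine Matrix.ext_col fun j => ?_
    exact hei (Pi.single j 1)
  have heΦ : e * Φ = Φ := by
    rw [Matrix.mul_fromCols, heI, heU]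
  let S₀ : Matrix (Fin s ⊕ Fin r) (Fin l) (Polynomial A) :=
    Matrix.fromRows (Matrix.of fun a j => Polynomial.C (k (e.col j) a))
      (Matrix.of fun a j => dv (V *ᵥ e.col j) a)
  have hΦS₀ : Φ * S₀ = e := by
    rw [Matrix.fromCols_mul_fromRows]
    refine Matrix.ext_col fun j => ?_
    have e1 : (I * (Matrix.of fun a j => Polynomial.C (k (e.col j) a))).col j =
        I *ᵥ fun a => Polynomial.C (k (e.col j) a) := rfl
    have e2 : (U * (Matrix.of fun a j => dv (V *ᵥ e.col j) a)).col j =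
        U *ᵥ dv (V *ᵥ e.col j) := rfl
    have e3 : e *ᵥ e.col j = e.col j := congrFun (congrArg Matrix.col he) j
    have e4 : ∀ P Q : Matrix (Fin l) (Fin l) (Polynomial A),
      (P + Q).col j = P.col j + Q.col j := fun _ _ => rfl
    rw [e4, e1, e2, hI, hik, e3, sub_add_cancel]
  have hΦS : Φ * (S₀ * e) = e := by rw [← Matrix.mul_assoc, hΦS₀, he]
  have hker : ∀ z, Φ *ᵥ z = 0 → ∃ y, z = Ψ *ᵥ y := by
    intro z hz
    obtain ⟨x₀, y, hx⟩ := exists_eq_C_add_charmatrix_mulVec τ (z ∘ Sum.inl)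
    have hz' : i x₀ + U *ᵥ (Λ *ᵥ y + z ∘ Sum.inr) = 0 := by
      rw [← hz, Matrix.fromCols_mulVec, hx, Matrix.mulVec_add, Matrix.mulVec_add, hI,
        Matrix.mulVec_mulVec _ I, hIτ, Matrix.mulVec_mulVec, add_assoc]
    have hx₀ : x₀ = 0 := by
      have := congrArg k hz'
      rwa [map_add, hki, hkU, add_zero, map_zero] at this
    rw [hx₀, map_zero, zero_add] at hz'
    have hw : f • (Λ *ᵥ y + z ∘ Sum.inr) = 0 := by
      rw [← hVU', hz', Matrix.mulVec_zero]
    have hw' := (smul_eq_zero_iff_right hf.ne_zero).1 hw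
    refine ⟨y, ?_⟩
    rw [Matrix.fromRows_mulVec, Matrix.neg_mulVec, ← eq_neg_of_add_eq_zero_right hw', ← Sum.elim_comp_inl_inr z, hx,
      hx₀]
    congr 1
    ext1 b
    simp
  have hinj : ∀ y, Ψ *ᵥ y = 0 → y = 0 := by
    intro y hy
    apply charmatrix_mulVec_injective τ
    ext1 a
    have := congrFun hy (Sum.inl a)
    simpa [Ψ, Matrix.fromRows_mulVec] using this
  exact exists_split_of_exact hcol e Φ (S₀ * e) Ψ hΦS heΦ hΦΨ hker hinj

theorem IdempotentsSplit.of_field (K : Type*) [Field K] : IdempotentsSplit K := by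
  intro l e he
  let P := LinearMap.range e.mulVecLin
  let b := Module.finBasis K P
  refine ⟨Module.finrank K P, LinearMap.toMatrix' (P.subtype ∘ₗ b.equivFun.symm.toLinearMap),
    LinearMap.toMatrix' (b.equivFun.toLinearMap ∘ₗ e.mulVecLin.rangeRestrict), ?_, ?_⟩
  · rw [← LinearMap.toMatrix'_comp]
    apply Matrix.toLin'.injective
    rw [Matrix.toLin'_toMatrix']
    refine LinearMap.ext fun x => ?_
    simp
  · rw [← LinearMap.toMatrix'_comp, ← LinearMap.toMatrix'_id]
    congr 1
    refine LinearMap.ext fun x => ?_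
    have : ∀ y : P, e.mulVecLin.rangeRestrict (y : Fin l → K) = y := by
      rintro ⟨_, y, rfl⟩
      apply Subtype.ext
      simp [he]
    simp only [LinearMap.comp_apply, LinearEquiv.coe_coe, Submodule.subtype_apply, this,
      LinearEquiv.apply_symm_apply, LinearMap.id_apply]

/-- A matrix over `MvPolynomial σ (FractionRing D)` has a common denominator in `D`. -/
theorem exists_smul_eq_map {D σ m n : Type*} [CommRing D] [IsDomain D] [Finite m] [Finite n]
    (U : Matrix m n (MvPolynomial σ (FractionRing D))) :
    ∃ (b : D) (_ : b ≠ 0) (U' : Matrix m n (MvPolynomial σ D)),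
      U'.map (MvPolynomial.map (algebraMap D (FractionRing D))) =
        (C (algebraMap D (FractionRing D) b) : MvPolynomial σ (FractionRing D)) • U := by
  let : Algebra (MvPolynomial σ D) (MvPolynomial σ (FractionRing D)) := algebraMvPolynomial
  obtain ⟨⟨_, b, hb, rfl⟩, h⟩ := IsLocalization.exist_integer_multiples_of_finite
    ((nonZeroDivisors D).map (C (σ := σ))) (fun ij : m × n => U ij.1 ij.2)
  choose g hg using h
  refine ⟨b, nonZeroDivisors.ne_zero hb, Matrix.of fun i j => g (i, j), ?_⟩
  ext1 i j
  have := hg (i, j)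
  simp only [algebraMap_def] at this
  simp only [Matrix.map_apply, Matrix.of_apply, this, Matrix.smul_apply, smul_eq_mul]
  refine (Algebra.smul_def _ _).trans ?_
  exact congrArg (· * U i j) (MvPolynomial.map_C (algebraMap D (FractionRing D)) b)

/-- An idempotent matrix which splits over the fraction field of the coefficient ring splits up
to a coefficient. -/
theorem exists_split_smul {D σ : Type*} [CommRing D] [IsDomain D]
    (h : IdempotentsSplit (MvPolynomial σ (FractionRing D))) {l : ℕ}
    (e : Matrix (Fin l) (Fin l) (MvPolynomial σ D)) (he : e * e = e) :
    ∃ (r : ℕ) (U : Matrix (Fin l) (Fin r) (MvPolynomial σ D))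
      (V : Matrix (Fin r) (Fin l) (MvPolynomial σ D)) (b : D), b ≠ 0 ∧
      U * V = (C b : MvPolynomial σ D) • e ∧ V * U = (C b : MvPolynomial σ D) • (1 : Matrix (Fin r) (Fin r) _) ∧
      e * U = U ∧ V * e = V := by
  let g : MvPolynomial σ D →+* MvPolynomial σ (FractionRing D) :=
    MvPolynomial.map (algebraMap D (FractionRing D))
  have hg : Function.Injective g :=
    MvPolynomial.map_injective _ (IsFractionRing.injective D (FractionRing D))
  have hinj : ∀ {m n : ℕ} {P Q : Matrix (Fin m) (Fin n) (MvPolynomial σ D)},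
      P.map g = Q.map g → P = Q := fun h => Matrix.map_injective hg h
  obtain ⟨r, U, V, h1, h2⟩ := h l (e.map g) (by rw [← Matrix.map_mul, he])
  obtain ⟨b, hb, U', hU⟩ := exists_smul_eq_map U
  obtain ⟨c, hc, V', hV⟩ := exists_smul_eq_map V
  change U'.map g = _ at hU
  change V'.map g = _ at hV
  have hs : ∀ {m n : ℕ} (a : D) (P : Matrix (Fin m) (Fin n) (MvPolynomial σ D)),
      ((C a : MvPolynomial σ D) • P).map g =
        (C (algebraMap D (FractionRing D) a) : MvPolynomial σ (FractionRing D)) • P.map g := by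
    intro m n a P
    ext1 i j
    simp [g]
  refine ⟨r, U', V', b * c, mul_ne_zero hb hc, hinj ?_, hinj ?_, hinj ?_, hinj ?_⟩
  · rw [Matrix.map_mul, hU, hV, hs, Matrix.smul_mul, Matrix.mul_smul, smul_smul, h1, map_mul,
      map_mul]
  · rw [Matrix.map_mul, hU, hV, hs, Matrix.smul_mul, Matrix.mul_smul, smul_smul, h2,
      Matrix.map_one _ (map_zero g) (map_one g), map_mul, map_mul, mul_comm (C _)]
  · rw [Matrix.map_mul, hU, Matrix.mul_smul, ← h1, Matrix.mul_assoc, h2, Matrix.mul_one]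
  · rw [Matrix.map_mul, hV, Matrix.smul_mul, ← h1, ← Matrix.mul_assoc, h2, Matrix.one_mul]

theorem ColumnsCompletable.of_ringEquiv {R S : Type*} [CommRing R] [CommRing S] (φ : R ≃+* S)
    (h : ColumnsCompletable R) : ColumnsCompletable S := by
  intro l v hv
  have := (h l (φ.symm ∘ v) (hv.map φ.symm.toRingHom)).map φ.toRingHom
  convert this using 1
  · ext1; simp
  · ext1 i
    by_cases hi : i = 0
    · subst hi
      simp
    · simp [hi]

theorem columnsCompletable_mvPolynomial (K : Type*) [Field K] (n : ℕ) :
    ColumnsCompletable (MvPolynomial (Fin n) K) :=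
  fun _ v hv => hv.colEquiv_single n v 0

/-- The Quillen–Suslin theorem: finitely generated projective modules over polynomial rings over
a field are free. -/
theorem idempotentsSplit_mvPolynomial (n : ℕ) (K : Type*) [Field K] :
    IdempotentsSplit (MvPolynomial (Fin n) K) := by
  induction n generalizing K with
  | zero => exact (IdempotentsSplit.of_field K).of_ringEquiv (isEmptyRingEquiv K (Fin 0)).symm
  | succ n ih =>
    have hcol : ColumnsCompletable (Polynomial (MvPolynomial (Fin n) K)) :=
      (columnsCompletable_mvPolynomial K (n + 1)).of_ringEquiv (finSuccEquiv K n).toRingEquiv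
    refine IdempotentsSplit.of_ringEquiv (finSuccEquiv K n).toRingEquiv.symm ?_
    intro l e he
    obtain ⟨θ, hθ⟩ : ∃ θ : MvPolynomial (Fin n) (Polynomial K) ≃+*
        Polynomial (MvPolynomial (Fin n) K), ∀ f, θ (C f) = f.map C := by
      refine ⟨((optionEquivRight K (Fin n)).symm.trans (optionEquivLeft K (Fin n))).toRingEquiv,
        fun f => ?_⟩
      have : (RingHomClass.toRingHom
          ((optionEquivRight K (Fin n)).symm.trans (optionEquivLeft K (Fin n)))).comp
          (C : Polynomial K →+* MvPolynomial (Fin n) (Polynomial K)) =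
          Polynomial.mapRingHom (C : K →+* MvPolynomial (Fin n) K) := by
        apply Polynomial.ringHom_ext
        · intro a
          have h1 := (AlgEquiv.symm_apply_eq _).2 (optionEquivRight_C K (Fin n) a).symm
          have h2 := optionEquivLeft_C K (Fin n) a
          simp [h1, h2]
        · have h1 := (AlgEquiv.symm_apply_eq _).2 (optionEquivRight_X_none K (Fin n)).symm
          have h2 := optionEquivLeft_X_none K (Fin n)
          simp [h1, h2]
      exact RingHom.congr_fun this f
    obtain ⟨r, U, V, b, hb, h1, h2, h3, h4⟩ := exists_split_smul
      (ih (FractionRing (Polynomial K))) (e.map θ.symm) (by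
        rw [← RingEquiv.coe_toRingHom, ← Matrix.map_mul, he])
    have hm : (b * Polynomial.C b.leadingCoeff⁻¹).Monic :=
      Polynomial.monic_mul_leadingCoeff_inv hb
    have hθe : (e.map θ.symm).map θ = e := by
      ext1 i j
      simp
    have hs : ∀ {m k : ℕ} (P : Matrix (Fin m) (Fin k) _), ((C b : MvPolynomial (Fin n) (Polynomial K)) • P).map θ =
        (b.map C : Polynomial (MvPolynomial (Fin n) K)) • P.map θ := by
      intro m n P
      ext1 i j
      simp [hθ]
    have hmul : ∀ {k m n : ℕ} (P : Matrix (Fin k) (Fin m) _) (Q : Matrix (Fin m) (Fin n) _),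
        (P * Q).map θ = P.map θ * Q.map θ := fun P Q => Matrix.map_mul (f := θ.toRingHom)
    refine exists_split_of_monic (ih K) hcol e he (hm.map (C (σ := Fin n)))
      ((Polynomial.C (C b.leadingCoeff⁻¹) : Polynomial (MvPolynomial (Fin n) K)) • U.map θ)
      (V.map θ) ?_ ?_ ?_ ?_
    · rw [Matrix.smul_mul, ← hmul, h1, hs, smul_smul, hθe, Polynomial.map_mul, mul_comm,
        Polynomial.map_C]
    · rw [Matrix.mul_smul, ← hmul, h2, hs, smul_smul, Polynomial.map_mul, mul_comm,
        Polynomial.map_C, Matrix.map_one _ (map_zero θ) (map_one θ)]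
    · rw [Matrix.mul_smul]
      conv_lhs => rw [← hθe, ← hmul, h3]
    · conv_lhs => rw [← hθe, ← hmul, h4]

/-- Idempotent matrices over a ring with `IdempotentsSplit` can be diagonalized. -/
theorem IdempotentsSplit.exists_diagonal {R : Type*} [CommRing R] [Nontrivial R]
    (h : IdempotentsSplit R) {l : ℕ} (E : Matrix (Fin l) (Fin l) R) (hE : E * E = E) :
    ∃ (N : (Matrix (Fin l) (Fin l) R)ˣ) (d : Fin l → R), (∀ i, d i = 0 ∨ d i = 1) ∧
      E * (N : Matrix (Fin l) (Fin l) R) = N * diagonal d := by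
  obtain ⟨r, U, V, h1, h2⟩ := h l E hE
  obtain ⟨s, U', V', h3, h4⟩ := h l (1 - E) (by simp [mul_sub, sub_mul, hE])
  have hV : V * E = V := by rw [← h1, ← Matrix.mul_assoc, h2, Matrix.one_mul]
  have hU : E * U = U := by rw [← h1, Matrix.mul_assoc, h2, Matrix.mul_one]
  have hV' : V' * (1 - E) = V' := by rw [← h3, ← Matrix.mul_assoc, h4, Matrix.one_mul]
  have hU' : (1 - E) * U' = U' := by rw [← h3, Matrix.mul_assoc, h4, Matrix.mul_one]
  have hEU' : E * U' = 0 := by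
    rw [← hU', ← Matrix.mul_assoc, mul_sub, hE, mul_one, sub_self, Matrix.zero_mul]
  have hEU : (1 - E) * U = 0 := by rw [Matrix.sub_mul, hU, Matrix.one_mul, sub_self]
  have hVU' : V * U' = 0 := by rw [← hV, Matrix.mul_assoc, hEU', Matrix.mul_zero]
  have hVU : V' * U = 0 := by rw [← hV', Matrix.mul_assoc, hEU, Matrix.mul_zero]
  have hWZ : fromCols U U' * fromRows V V' = 1 := by
    rw [fromCols_mul_fromRows, h1, h3, add_sub_cancel]
  have hZW : fromRows V V' * fromCols U U' = 1 := by
    rw [fromRows_mul_fromCols, h2, h4, hVU, hVU', fromBlocks_one]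
  have hcard : l = r + s := by
    simpa using Matrix.square_of_invertible _ _ hWZ hZW
  let e : Fin l ≃ Fin r ⊕ Fin s := (finCongr hcard).trans finSumFinEquiv.symm
  refine ⟨⟨(fromCols U U').submatrix id e, (fromRows V V').submatrix e id, ?_, ?_⟩,
    Sum.elim 1 0 ∘ e, fun i => ?_, ?_⟩
  · rw [Matrix.submatrix_mul_equiv, hWZ, Matrix.submatrix_id_id]
  · rw [← Matrix.submatrix_mul _ _ _ _ _ Function.bijective_id, hZW, Matrix.submatrix_one_equiv]
  · rcases h : e i with j | j <;> simp [h]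
  · have hD : fromCols U U' * diagonal (Sum.elim (1 : Fin r → R) (0 : Fin s → R)) =
        E * fromCols U U' := by
      rw [mul_fromCols, hU, hEU']
      ext i (j | j) <;> simp [mul_diagonal]
    ext i j
    have := congrFun (congrFun hD i) (e j)
    rw [mul_diagonal] at this
    rw [mul_diagonal]
    exact this.symm

section Minors

variable {R : Type*} [CommRing R] {l m : ℕ}

theorem det_submatrix_mem_minorsSet_or_eq_zero {k : ℕ} (F : Matrix (Fin l) (Fin m) R)
    (ri : Fin k → Fin l) (ci : Fin k → Fin m) :
    (F.submatrix ri ci).det ∈ minorsSet k F ∨ (F.submatrix ri ci).det = 0 := by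
  by_cases hr : Function.Injective ri
  · by_cases hc : Function.Injective ci
    · exact Or.inl ⟨ri, ci, hr, hc, rfl⟩
    · right
      obtain ⟨i, j, hij, hne⟩ := by simpa [Function.Injective] using hc
      exact Matrix.det_zero_of_column_eq hne fun k => by simp [hij]
  · right
    obtain ⟨i, j, hij, hne⟩ := by simpa [Function.Injective] using hr
    exact Matrix.det_zero_of_row_eq hne (by ext k; simp [hij])

theorem det_submatrix_mem_span_minorsSet {k : ℕ} (F : Matrix (Fin l) (Fin m) R)
    (ri : Fin k → Fin l) (ci : Fin k → Fin m) :
    (F.submatrix ri ci).det ∈ Ideal.span (minorsSet k F) := by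
  rcases det_submatrix_mem_minorsSet_or_eq_zero F ri ci with h | h
  · exact Ideal.subset_span h
  · simp [h]

/-- Bordered determinants vanish when all minors of the next size do. -/
theorem mul_adjugate_mul_of_minors_eq_zero [IsDomain R] {k : ℕ} (F : Matrix (Fin l) (Fin m) R)
    (h : ∀ x ∈ minorsSet (k + 1) F, x = 0) (ri : Fin k → Fin l) (ci : Fin k → Fin m)
    (hdet : (F.submatrix ri ci).det ≠ 0) :
    F.submatrix id ci * (F.submatrix ri ci).adjugate * F.submatrix ri id =
      (F.submatrix ri ci).det • F := by
  ext i j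
  obtain ⟨M, hM⟩ : ∃ M, M = F.submatrix ri ci := ⟨_, rfl⟩
  let b : Matrix (Fin k) (Fin 1) R := F.submatrix ri fun _ => j
  let c : Matrix (Fin 1) (Fin k) R := F.submatrix (fun _ => i) ci
  let d : Matrix (Fin 1) (Fin 1) R := F.submatrix (fun _ => i) fun _ => j
  have h0 : (fromBlocks M b c d).det = 0 := by
    have : fromBlocks M b c d = (F.submatrix (Sum.elim ri (fun _ => i) ∘ finSumFinEquiv.symm)
        (Sum.elim ci (fun _ => j) ∘ finSumFinEquiv.symm)).submatrix finSumFinEquiv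
          finSumFinEquiv := by
      ext (x | x) (y | y) <;> simp [b, c, d, hM]
    rw [this, Matrix.det_submatrix_equiv_self]
    rcases det_submatrix_mem_minorsSet_or_eq_zero F _ _ with h' | h'
    · exact h _ h'
    · exact h'
  have h1 : fromBlocks M b c d * fromBlocks M.adjugate (-(M.adjugate * b)) 0 (M.det • 1) =
      fromBlocks (M.det • 1) 0 (c * M.adjugate) (M.det • d - c * M.adjugate * b) := by
    rw [fromBlocks_multiply]
    congr 1
    · simp [mul_adjugate]
    · rw [Matrix.mul_neg, ← Matrix.mul_assoc, mul_adjugate]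
      simp
    · simp
    · rw [Matrix.mul_neg, ← Matrix.mul_assoc]
      simp [sub_eq_neg_add]
  have h2 := congrArg Matrix.det h1
  rw [Matrix.det_mul, h0, zero_mul, Matrix.det_fromBlocks_zero₁₂] at h2
  have h3 : (M.det • d - c * M.adjugate * b).det = 0 := by
    rcases mul_eq_zero.1 h2.symm with h | h
    · rw [Matrix.det_smul, Matrix.det_one, mul_one] at h
      exact absurd h (pow_ne_zero _ (hM ▸ hdet))
    · exact h
  rw [Matrix.det_fin_one, Matrix.sub_apply, sub_eq_zero] at h3
  rw [← hM]
  simpa [b, c, d, Matrix.mul_apply] using h3.symm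

/-- If the `k`-minors of `F` generate a principal ideal `(a)` and the larger minors vanish, then
the kernel of `F` is the kernel of an idempotent. -/
theorem exists_idempotent_of_minors [IsDomain R] {k : ℕ} (F : Matrix (Fin l) (Fin m) R) {a : R}
    (ha : a ≠ 0) (hspan : Ideal.span (minorsSet k F) = Ideal.span {a})
    (h : ∀ x ∈ minorsSet (k + 1) F, x = 0) :
    ∃ (E : Matrix (Fin m) (Fin m) R) (H : Matrix (Fin m) (Fin l) R),
      F * E = F ∧ a • E = H * F := by
  have hdvd : ∀ (ri : Fin k → Fin l) (ci : Fin k → Fin m), a ∣ (F.submatrix ri ci).det := by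
    intro ri ci
    rw [← Ideal.mem_span_singleton, ← hspan]
    exact det_submatrix_mem_span_minorsSet F ri ci
  have key : ∀ x ∈ Ideal.span (minorsSet k F), ∃ (E : Matrix (Fin m) (Fin m) R)
      (H : Matrix (Fin m) (Fin l) R), F * H * F = x • F ∧ a • E = H * F := by
    intro x hx
    induction hx using Submodule.span_induction with
    | zero => exact ⟨0, 0, by simp, by simp⟩
    | add x y _ _ hx hy =>
      obtain ⟨E, H, h1, h2⟩ := hx
      obtain ⟨E', H', h1', h2'⟩ := hy
      exact ⟨E + E', H + H', by rw [Matrix.mul_add, Matrix.add_mul, h1, h1', add_smul],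
        by rw [smul_add, h2, h2', Matrix.add_mul]⟩
    | smul c x _ hx =>
      obtain ⟨E, H, h1, h2⟩ := hx
      exact ⟨c • E, c • H, by rw [Matrix.mul_smul, Matrix.smul_mul, h1, smul_assoc],
        by rw [smul_comm, h2, Matrix.smul_mul]⟩
    | mem x hx =>
      obtain ⟨ri, ci, -, -, rfl⟩ := hx
      by_cases hdet : (F.submatrix ri ci).det = 0
      · exact ⟨0, 0, by simp [hdet], by simp⟩
      have hE : ∀ i j, a ∣ ((F.submatrix ri ci).adjugate * F.submatrix ri id) i j := by
        intro i j
        have : ((F.submatrix ri ci).adjugate * F.submatrix ri id) i j =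
            (F.submatrix ri (Function.update ci i j)).det := by
          have h1 : ((F.submatrix ri ci).adjugate * F.submatrix ri id) i j =
              ((F.submatrix ri ci).adjugate *ᵥ fun x => F (ri x) j) i := rfl
          rw [h1, ← Matrix.cramer_eq_adjugate_mulVec, Matrix.cramer_apply]
          congr 1
          ext x y
          by_cases hy : y = i
          · subst hy; simp
          · simp [hy]
        rw [this]
        exact hdvd _ _
      choose E' hE' using hE
      let ι : Matrix (Fin m) (Fin k) R := (1 : Matrix (Fin m) (Fin m) R).submatrix id ci
      let π : Matrix (Fin k) (Fin l) R := (1 : Matrix (Fin l) (Fin l) R).submatrix ri id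
      have hι : F * ι = F.submatrix id ci := by
        rw [← Matrix.submatrix_id_id F, ← Matrix.submatrix_mul _ _ _ _ _ Function.bijective_id,
          Matrix.mul_one]
        simp
      have hπ : π * F = F.submatrix ri id := by
        rw [← Matrix.submatrix_id_id F, ← Matrix.submatrix_mul _ _ _ _ _ Function.bijective_id,
          Matrix.one_mul]
        simp
      refine ⟨ι * Matrix.of E', ι * (F.submatrix ri ci).adjugate * π, ?_, ?_⟩
      · rw [← mul_adjugate_mul_of_minors_eq_zero F h ri ci hdet, ← hι, ← hπ]
        simp only [Matrix.mul_assoc]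
      · rw [Matrix.mul_assoc, hπ, Matrix.mul_assoc, ← Matrix.mul_smul]
        congr 1
        ext i j
        exact (hE' i j).symm
  obtain ⟨E, H, h1, h2⟩ := key a (hspan ▸ Ideal.mem_span_singleton_self a)
  refine ⟨E, H, ?_, h2⟩
  apply smul_right_injective _ ha
  change a • (F * E) = a • F
  rw [← Matrix.mul_smul, h2, ← Matrix.mul_assoc, h1]

end Minors

/-- Commuting retractions of `R` along `t₁` and `t₂`, as given by substituting `0` for one of two
independent variables. -/
structure RetractionPair {R : Type*} [CommRing R] (t₁ t₂ : R) (ρ₁ ρ₂ : R →+* R) : Prop where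
  dvd_sub_left : ∀ g, t₁ ∣ g - ρ₁ g
  dvd_sub_right : ∀ g, t₂ ∣ g - ρ₂ g
  left_left : ρ₁ t₁ = 0
  left_right : ρ₁ t₂ = t₂
  right_left : ρ₂ t₁ = t₁
  right_right : ρ₂ t₂ = 0
  comm : ∀ g, ρ₁ (ρ₂ g) = ρ₂ (ρ₁ g)

namespace RetractionPair

variable {R : Type*} [CommRing R] {t₁ t₂ : R} {ρ₁ ρ₂ : R →+* R}

theorem symm (h : RetractionPair t₁ t₂ ρ₁ ρ₂) : RetractionPair t₂ t₁ ρ₂ ρ₁ :=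
  ⟨h.dvd_sub_right, h.dvd_sub_left, h.right_right, h.right_left, h.left_right, h.left_left,
    fun g => (h.comm g).symm⟩

theorem left_idem (h : RetractionPair t₁ t₂ ρ₁ ρ₂) (g : R) : ρ₁ (ρ₁ g) = ρ₁ g := by
  obtain ⟨c, hc⟩ := h.dvd_sub_left g
  have := congrArg ρ₁ hc
  rw [map_sub, map_mul, h.left_left, zero_mul, sub_eq_zero] at this
  exact this.symm

end RetractionPair

theorem UnimodularCol.of_mulVec {R ι κ : Type*} [CommRing R] [Fintype ι] [Fintype κ]
    (H : Matrix κ ι R) {v : ι → R} (h : UnimodularCol (H *ᵥ v)) : UnimodularCol v := by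
  obtain ⟨w, hw⟩ := h
  exact ⟨w ᵥ* H, by rw [← Matrix.dotProduct_mulVec, hw]⟩

theorem UnimodularCol.units_mulVec {R ι : Type*} [CommRing R] [Fintype ι] [DecidableEq ι]
    (M : (Matrix ι ι R)ˣ) {v : ι → R} (h : UnimodularCol v) :
    UnimodularCol ((M : Matrix ι ι R) *ᵥ v) :=
  ColEquiv.unimodularCol ⟨M, rfl⟩ h

theorem unimodularCol_iff_span_range {R ι : Type*} [CommRing R] [Fintype ι] {v : ι → R} :
    UnimodularCol v ↔ Ideal.span (Set.range v) = ⊤ := by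
  rw [Ideal.eq_top_iff_one, Ideal.mem_span_range_iff_exists_fun]
  rfl

theorem dotProduct_mem_span_range {R ι : Type*} [CommRing R] [Fintype ι] (w v : ι → R) :
    w ⬝ᵥ v ∈ Ideal.span (Set.range v) :=
  Ideal.mem_span_range_iff_exists_fun.2 ⟨w, rfl⟩

theorem dotProduct_comp_mem_of_dvd_sub {R ι : Type*} [CommRing R] [Fintype ι] {t : R}
    {ρ : R →+* R} (h : ∀ g, t ∣ g - ρ g) (w v : ι → R) {I : Ideal R} (hI : ∀ i, v i ∈ I)
    (ht : t ∈ I) : w ⬝ᵥ (ρ ∘ v) ∈ I := by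
  refine Ideal.sum_mem _ fun i _ => I.mul_mem_left _ ?_
  have := I.sub_mem (hI i) (I.mem_of_dvd (h (v i)) ht)
  simpa using this

theorem minorsSet_map {R S : Type*} [CommRing R] [CommRing S] {l m k : ℕ}
    (f : R →+* S) (F : Matrix (Fin l) (Fin m) R) :
    minorsSet k (F.map f) = f '' minorsSet k F := by
  ext x
  constructor
  · rintro ⟨ri, ci, hr, hc, rfl⟩
    exact ⟨_, ⟨ri, ci, hr, hc, rfl⟩, by rw [RingHom.map_det]; rfl⟩
  · rintro ⟨_, ⟨ri, ci, hr, hc, rfl⟩, rfl⟩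
    exact ⟨ri, ci, hr, hc, by rw [RingHom.map_det]; rfl⟩

theorem map_map_eq_of_idem {R ι κ : Type*} [CommRing R] {ρ : R →+* R}
    (h : ∀ g, ρ (ρ g) = ρ g) (M : Matrix ι κ R) : (M.map ρ).map ρ = M.map ρ := by
  ext; simp [h]

/-- Reduction of a matrix modulo `t`, together with an idempotent having the same kernel and its
diagonalization. -/
theorem exists_reduction {R : Type*} [CommRing R] [IsDomain R] (hR : IdempotentsSplit R)
    {t : R} {ρ : R →+* R} (hρ : ∀ g, ρ (ρ g) = ρ g) (ht : ρ t = 0) {l m r : ℕ}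
    (F : Matrix (Fin l) (Fin m) R) {a b : R} (ha : a ≠ 0) (hab : ρ b = a)
    (hF : Ideal.span (minorsSet r F) = Ideal.span {b}) (hF' : ∀ x ∈ minorsSet (r + 1) F, t ∣ x) :
    ∃ (E : Matrix (Fin m) (Fin m) R) (H : Matrix (Fin m) (Fin l) R)
      (N : (Matrix (Fin m) (Fin m) R)ˣ) (d : Fin m → R), (∀ i, d i = 0 ∨ d i = 1) ∧
      E.map ρ = E ∧ (N : Matrix (Fin m) (Fin m) R).map ρ = N ∧ F.map ρ * E = F.map ρ ∧
      a • E = H * F.map ρ ∧ E * (N : Matrix (Fin m) (Fin m) R) = N * diagonal d := by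
  obtain ⟨E, H, h1, h2⟩ := exists_idempotent_of_minors (k := r) (F.map ρ) ha (by
    rw [minorsSet_map, ← Ideal.map_span, hF, Ideal.map_span, Set.image_singleton, hab]) (by
    rw [minorsSet_map]
    rintro _ ⟨x, hx, rfl⟩
    obtain ⟨c, rfl⟩ := hF' x hx
    rw [map_mul, ht, zero_mul])
  have ha' : ρ a = a := by rw [← hab, hρ]
  have hE : E * E = E := by
    apply smul_right_injective _ ha
    change a • (E * E) = a • E
    rw [← Matrix.smul_mul, h2, Matrix.mul_assoc, h1]
  obtain ⟨N, d, hd, hN⟩ := hR.exists_diagonal (E.map ρ) (by rw [← Matrix.map_mul, hE])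
  refine ⟨E.map ρ, H.map ρ, Units.map (ρ.mapMatrix (m := Fin m)).toMonoidHom N, d, hd,
    map_map_eq_of_idem hρ E, map_map_eq_of_idem hρ _, ?_, ?_, ?_⟩
  · conv_lhs => rw [← map_map_eq_of_idem hρ F, ← Matrix.map_mul, h1, map_map_eq_of_idem hρ F]
  · have := congrArg (fun M : Matrix (Fin m) (Fin m) R => M.map ρ) h2
    simp only [Matrix.map_mul, map_map_eq_of_idem hρ] at this
    rw [← this]
    ext i j
    simp [ha']
  · have := congrArg (fun M : Matrix (Fin m) (Fin m) R => M.map ρ) hN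
    simp only [Matrix.map_mul, map_map_eq_of_idem hρ] at this
    refine this.trans ?_
    congr 1
    ext i j
    rcases hd j with h | h <;> by_cases hij : i = j <;> simp [hij, h]

theorem map_diagonal_eq {R m : Type*} [CommRing R] [DecidableEq m] (σ : R →+* R)
    {d : m → R} (hd : ∀ i, d i = 0 ∨ d i = 1) : (diagonal d).map σ = diagonal d := by
  rw [Matrix.diagonal_map (map_zero σ)]
  congr 1
  ext j
  rcases hd j with h | h <;> simp [h]

/-- A diagonalization of an idempotent `E` fixed by `ρ` provides an automorphism conjugating `E`
to its reduction under a retraction `σ` commuting with `ρ`. -/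
theorem exists_transition {R m : Type*} [CommRing R] [Fintype m] [DecidableEq m]
    {ρ σ : R →+* R} (hσ : ∀ g, σ (σ g) = σ g) (hρσ : ∀ g, ρ (σ g) = σ (ρ g))
    (E : Matrix m m R) (N : (Matrix m m R)ˣ) {d : m → R} (hd : ∀ i, d i = 0 ∨ d i = 1)
    (hN : (N : Matrix m m R).map ρ = N) (hEN : E * (N : Matrix m m R) = N * diagonal d) :
    ∃ T : (Matrix m m R)ˣ, (T : Matrix m m R).map ρ = T ∧ (T : Matrix m m R).map σ = 1 ∧
      E * (T : Matrix m m R) = T * E.map σ := by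
  let ρ' := GeneralLinearGroup.map (n := m) ρ
  let σ' := GeneralLinearGroup.map (n := m) σ
  have hρ' : ρ' N = N := Units.ext hN
  have hσ' : σ' (σ' N) = σ' N := Units.ext (by ext i j; exact hσ _)
  have hρσ' : ρ' (σ' N) = σ' N := by
    conv_rhs => rw [← hρ']
    exact Units.ext (by ext i j; exact hρσ _)
  have hEσ : E.map σ * (σ' N : Matrix m m R) = (σ' N : Matrix m m R) * diagonal d := by
    have := congrArg (fun M : Matrix m m R => M.map σ) hEN
    simp only [Matrix.map_mul, map_diagonal_eq σ hd] at this
    exact this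
  refine ⟨N * (σ' N)⁻¹, ?_, ?_, ?_⟩
  · have : ρ' (N * (σ' N)⁻¹) = N * (σ' N)⁻¹ := by rw [map_mul, map_inv, hρ', hρσ']
    exact congrArg Units.val this
  · have : σ' (N * (σ' N)⁻¹) = 1 := by rw [map_mul, map_inv, hσ', mul_inv_cancel]
    exact congrArg Units.val this
  · rw [Units.val_mul, ← mul_assoc, hEN, mul_assoc, mul_assoc]
    congr 1
    rw [Units.eq_inv_mul_iff_mul_eq, ← mul_assoc, ← hEσ, mul_assoc, Units.mul_inv, mul_one]

/-- The gluing step: a unimodular column with unimodular image under `F`. -/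
theorem exists_unimodularCol_mulVec {R : Type*} [CommRing R] [IsDomain R]
    (hR : IdempotentsSplit R) {t₁ t₂ : R} {ρ₁ ρ₂ : R →+* R} (h : RetractionPair t₁ t₂ ρ₁ ρ₂)
    (ht₁ : t₁ ≠ 0) {l r s e f N : ℕ} (F : Matrix (Fin l) (Fin l) R)
    (hone : Ideal.span (minorsSet 1 F) = ⊤)
    (hr : Ideal.span (minorsSet r F) = ⊤) (hr' : ∀ x ∈ minorsSet (r + 1) F, t₁ ∣ x)
    (hs : Ideal.span (minorsSet s F) = Ideal.span {t₁ ^ N})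
    (hs' : ∀ x ∈ minorsSet (s + 1) F, t₂ ∣ x)
    (hdet : F.det ∣ t₁ ^ e * t₂ ^ f) :
    ∃ u : Fin l → R, UnimodularCol u ∧ UnimodularCol (F *ᵥ u) := by
  obtain ⟨E₁, H₁, N₁, d₁, hd₁, hE₁, hN₁, hFE₁, hH₁, hEN₁⟩ :=
    exists_reduction hR h.left_idem h.left_left F one_ne_zero (map_one ρ₁)
      (hr.trans Ideal.span_singleton_one.symm) hr'
  obtain ⟨E₂, H₂, N₂, d₂, hd₂, hE₂, hN₂, hFE₂, hH₂, hEN₂⟩ :=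
    exists_reduction hR h.symm.left_idem h.right_right F (pow_ne_zero N ht₁)
      (by rw [map_pow, h.right_left]) hs hs'
  rw [one_smul] at hH₁
  obtain ⟨T₁, hT₁, hT₁', hET₁⟩ := exists_transition h.symm.left_idem h.comm E₁ N₁ hd₁ hN₁ hEN₁
  obtain ⟨T₂, hT₂, hT₂', hET₂⟩ := exists_transition h.left_idem (fun g => (h.comm g).symm)
    E₂ N₂ hd₂ hN₂ hEN₂
  have hE₂E₂ : E₂ * E₂ = E₂ := by
    apply smul_right_injective _ (pow_ne_zero N ht₁)
    change t₁ ^ N • (E₂ * E₂) = t₁ ^ N • E₂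
    rw [← Matrix.smul_mul, hH₂, Matrix.mul_assoc, hFE₂]
  have hcomm : ∀ M : Matrix (Fin l) (Fin l) R, (M.map ρ₁).map ρ₂ = (M.map ρ₂).map ρ₁ := by
    intro M; ext i j; exact (h.comm _).symm
  have hEE : E₁.map ρ₂ * E₂.map ρ₁ = E₁.map ρ₂ := by
    rw [hH₁, Matrix.map_mul, Matrix.mul_assoc, hcomm F, ← Matrix.map_mul, hFE₂]
  obtain ⟨i, hi⟩ : ∃ i, d₁ i = 1 := by
    by_contra! hne
    have hd : d₁ = 0 := funext fun i => (hd₁ i).resolve_right (hne i)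
    have hE : E₁ = 0 := by
      rw [hd, Pi.zero_def, diagonal_zero, mul_zero] at hEN₁
      exact (Units.mul_left_eq_zero N₁).1 hEN₁
    have hF0 : F.map ρ₁ = 0 := by rw [← hFE₁, hE, mul_zero]
    have : (1 : R) ∈ Ideal.map ρ₁ (Ideal.span (minorsSet 1 F)) := by
      rw [hone, Ideal.map_top]; trivial
    rw [Ideal.map_span, ← minorsSet_map, hF0] at this
    refine one_ne_zero (α := R) ((Ideal.mem_bot).1 (Ideal.span_le.2 ?_ this))
    rintro _ ⟨ri, ci, -, -, rfl⟩
    simp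
  obtain ⟨w, hw₀⟩ : ∃ w, w = (N₁ : Matrix (Fin l) (Fin l) R).map ρ₂ *ᵥ Pi.single i 1 := ⟨_, rfl⟩
  have hw : UnimodularCol w := hw₀ ▸ UnimodularCol.units_mulVec
    (GeneralLinearGroup.map (n := Fin l) ρ₂ N₁) ⟨Pi.single i 1, by simp⟩
  have hmap : ∀ (ρ : R →+* R) (A : Matrix (Fin l) (Fin l) R) (v : Fin l → R),
      ρ ∘ (A *ᵥ v) = A.map ρ *ᵥ (ρ ∘ v) := fun ρ A v => funext (RingHom.map_mulVec ρ A v)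
  have hsingle : ∀ ρ : R →+* R, ρ ∘ (Pi.single i 1 : Fin l → R) = Pi.single i 1 := by
    intro ρ
    ext j
    by_cases hj : j = i
    · subst hj; simp
    · simp [hj]
  have hw₁ : ρ₁ ∘ w = w := by
    rw [hw₀, hmap, hsingle, ← hcomm, hN₁]
  have hw₂ : ρ₂ ∘ w = w := by
    rw [hw₀, hmap, hsingle, map_map_eq_of_idem h.symm.left_idem]
  have hEw : E₁.map ρ₂ *ᵥ w = w := by
    have := congrArg (fun A : Matrix (Fin l) (Fin l) R => A.map ρ₂) hEN₁
    simp only [Matrix.map_mul, map_diagonal_eq ρ₂ hd₁] at this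
    rw [hw₀, Matrix.mulVec_mulVec, this, ← Matrix.mulVec_mulVec]
    congr 1
    ext j
    by_cases hj : j = i
    · subst hj; simp [hi]
    · simp [hj]
  obtain ⟨y, hy⟩ : ∃ y, y = E₂.map ρ₁ *ᵥ w := ⟨_, rfl⟩
  have hy₁ : ρ₁ ∘ y = y := by
    rw [hy, hmap, hw₁, map_map_eq_of_idem h.left_idem]
  have hy₂ : ρ₂ ∘ y = y := by
    rw [hy, hmap, hw₂, hcomm, hE₂]
  have hE₁y : E₁.map ρ₂ *ᵥ y = w := by rw [hy, Matrix.mulVec_mulVec, hEE, hEw]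
  have hE₂y : E₂.map ρ₁ *ᵥ y = y := by
    rw [hy, Matrix.mulVec_mulVec, ← Matrix.map_mul, hE₂E₂]
  have hyu : UnimodularCol y := UnimodularCol.of_mulVec (E₁.map ρ₂) (hE₁y.symm ▸ hw)
  obtain ⟨u₂, hu₂⟩ : ∃ u₂, u₂ = (T₂ : Matrix (Fin l) (Fin l) R) *ᵥ y := ⟨_, rfl⟩
  obtain ⟨u, hu⟩ : ∃ u, u = (T₁ : Matrix (Fin l) (Fin l) R) *ᵥ u₂ := ⟨_, rfl⟩
  have hu₂u : UnimodularCol u₂ := hu₂ ▸ hyu.units_mulVec T₂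
  have huu : UnimodularCol u := hu ▸ hu₂u.units_mulVec T₁
  have hρ₁u₂ : ρ₁ ∘ u₂ = y := by rw [hu₂, hmap, hT₂', hy₁, Matrix.one_mulVec]
  have hρ₂u₂ : ρ₂ ∘ u₂ = u₂ := by rw [hu₂, hmap, hT₂, hy₂]
  have hρ₁u : ρ₁ ∘ u = (T₁ : Matrix (Fin l) (Fin l) R) *ᵥ y := by rw [hu, hmap, hT₁, hρ₁u₂]
  have hρ₂u : ρ₂ ∘ u = u₂ := by rw [hu, hmap, hT₁', hρ₂u₂, Matrix.one_mulVec]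
  have hu₁' : UnimodularCol (ρ₁ ∘ (F *ᵥ u)) := by
    refine UnimodularCol.of_mulVec H₁ ?_
    rw [hmap, hρ₁u, Matrix.mulVec_mulVec, ← hH₁, Matrix.mulVec_mulVec, hET₁,
      ← Matrix.mulVec_mulVec, hE₁y]
    exact hw.units_mulVec T₁
  have hu₂' : H₂ *ᵥ (ρ₂ ∘ (F *ᵥ u)) = t₁ ^ N • u₂ := by
    rw [hmap, hρ₂u, Matrix.mulVec_mulVec, ← hH₂, Matrix.smul_mulVec, hu₂, Matrix.mulVec_mulVec,
      hET₂, ← Matrix.mulVec_mulVec, hE₂y]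
  refine ⟨u, huu, unimodularCol_iff_span_range.2 ?_⟩
  by_contra hne
  obtain ⟨P, hP, hle⟩ := Ideal.exists_le_maximal _ hne
  have hmem : ∀ i, (F *ᵥ u) i ∈ P := fun i => hle (Ideal.subset_span ⟨i, rfl⟩)
  have hP₁ : t₁ ∉ P := by
    intro ht
    obtain ⟨c, hc⟩ := hu₁'
    refine (Ideal.ne_top_iff_one P).1 hP.ne_top ?_
    rw [← hc]
    exact dotProduct_comp_mem_of_dvd_sub h.dvd_sub_left _ _ hmem ht
  have hP₂ : t₂ ∉ P := by
    intro ht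
    obtain ⟨c, hc⟩ := hu₂u
    refine hP₁ (hP.isPrime.mem_of_pow_mem N ?_)
    have : (c ᵥ* H₂) ⬝ᵥ (ρ₂ ∘ (F *ᵥ u)) = t₁ ^ N := by
      rw [← Matrix.dotProduct_mulVec, hu₂', dotProduct_smul, hc, smul_eq_mul, mul_one]
    rw [← this]
    exact dotProduct_comp_mem_of_dvd_sub h.dvd_sub_right _ _ hmem ht
  have hdetP : F.det ∈ P := by
    obtain ⟨c, hc⟩ := huu
    have : (c ᵥ* F.adjugate) ⬝ᵥ (F *ᵥ u) = F.det := by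
      rw [← Matrix.dotProduct_mulVec, Matrix.mulVec_mulVec, Matrix.adjugate_mul,
        Matrix.smul_mulVec, Matrix.one_mulVec, dotProduct_smul, hc, smul_eq_mul, mul_one]
    rw [← this]
    exact hle (dotProduct_mem_span_range _ _)
  rcases hP.isPrime.mem_or_mem (P.mem_of_dvd hdet hdetP) with h | h
  · exact hP₁ (hP.isPrime.mem_of_pow_mem _ h)
  · exact hP₂ (hP.isPrime.mem_of_pow_mem _ h)

section MinorIdeals

variable {R : Type*} [CommRing R] {l m n k : ℕ}

theorem minorsSet_transpose (F : Matrix (Fin l) (Fin m) R) : minorsSet k Fᵀ = minorsSet k F := by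
  ext x
  constructor <;>
  · rintro ⟨ri, ci, hr, hc, rfl⟩
    exact ⟨ci, ri, hc, hr, by rw [← Matrix.det_transpose]; rfl⟩

theorem span_minorsSet_mul_left_le (P : Matrix (Fin n) (Fin l) R) (F : Matrix (Fin l) (Fin m) R) :
    Ideal.span (minorsSet k (P * F)) ≤ Ideal.span (minorsSet k F) := by
  rw [Ideal.span_le]
  rintro _ ⟨ri, ci, -, -, rfl⟩
  have h : ((P * F).submatrix ri ci).det = Matrix.detRowAlternating
      (fun i => ∑ x, P (ri i) x • fun j => F x (ci j)) := by
    congr 1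
    ext i j
    simp [Matrix.mul_apply]
  rw [h, ← AlternatingMap.coe_multilinearMap, MultilinearMap.map_sum]
  refine Ideal.sum_mem _ fun r _ => ?_
  rw [MultilinearMap.map_smul_univ]
  exact Ideal.mul_mem_left _ _ (det_submatrix_mem_span_minorsSet F r ci)

theorem span_minorsSet_mul_right_le (F : Matrix (Fin l) (Fin m) R) (Q : Matrix (Fin m) (Fin n) R) :
    Ideal.span (minorsSet k (F * Q)) ≤ Ideal.span (minorsSet k F) := by
  rw [← minorsSet_transpose, Matrix.transpose_mul, ← minorsSet_transpose F]
  exact span_minorsSet_mul_left_le _ _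

theorem span_minorsSet_succ_le (F : Matrix (Fin l) (Fin m) R) :
    Ideal.span (minorsSet (k + 1) F) ≤ Ideal.span (minorsSet k F) := by
  rw [Ideal.span_le]
  rintro _ ⟨ri, ci, -, -, rfl⟩
  rw [Matrix.det_succ_row_zero]
  refine Ideal.sum_mem _ fun j _ => Ideal.mul_mem_left _ _ ?_
  rw [Matrix.submatrix_submatrix]
  exact det_submatrix_mem_span_minorsSet F _ _

theorem span_minorsSet_smul (d : R) (F : Matrix (Fin l) (Fin m) R) :
    Ideal.span (minorsSet k (d • F)) = Ideal.span {d ^ k} * Ideal.span (minorsSet k F) := by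
  rw [Ideal.span_mul_span']
  congr 1
  ext x
  simp only [Set.singleton_mul, Set.mem_image]
  constructor
  · rintro ⟨ri, ci, hr, hc, rfl⟩
    exact ⟨_, ⟨ri, ci, hr, hc, rfl⟩, by simp [Matrix.submatrix_smul]⟩
  · rintro ⟨_, ⟨ri, ci, hr, hc, rfl⟩, rfl⟩
    exact ⟨ri, ci, hr, hc, by simp [Matrix.submatrix_smul]⟩

theorem minorsSet_zero (F : Matrix (Fin l) (Fin m) R) : minorsSet 0 F = {1} := by
  ext x
  constructor
  · rintro ⟨ri, ci, -, -, rfl⟩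
    simp
  · rintro rfl
    exact ⟨Fin.elim0, Fin.elim0, fun i => i.elim0, fun i => i.elim0, by simp⟩

theorem apply_mem_minorsSet_one (F : Matrix (Fin l) (Fin m) R) (i : Fin l) (j : Fin m) :
    F i j ∈ minorsSet 1 F :=
  ⟨fun _ => i, fun _ => j, Function.injective_of_subsingleton _,
    Function.injective_of_subsingleton _, by simp⟩

theorem minorsSet_eq_empty (F : Matrix (Fin l) (Fin m) R) (h : l < k) : minorsSet k F = ∅ := by
  refine Set.eq_empty_of_forall_notMem ?_
  rintro _ ⟨ri, ci, hr, -, -⟩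
  have := Fintype.card_le_of_injective ri hr
  simp only [Fintype.card_fin] at this
  omega

theorem det_dvd_of_mem_span_minorsSet (F : Matrix (Fin l) (Fin l) R) {x : R}
    (hx : x ∈ Ideal.span (minorsSet l F)) : F.det ∣ x := by
  rw [← Ideal.mem_span_singleton]
  refine Ideal.span_le.2 ?_ hx
  rintro _ ⟨ri, ci, -, -, rfl⟩
  have : F.submatrix ri ci = (1 : Matrix (Fin l) (Fin l) R).submatrix ri id * F *
      (1 : Matrix (Fin l) (Fin l) R).submatrix id ci := by
    conv_rhs => enter [1, 2]; rw [← Matrix.submatrix_id_id F]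
    rw [← Matrix.submatrix_mul _ _ _ _ _ Function.bijective_id,
      ← Matrix.submatrix_mul _ _ _ _ _ Function.bijective_id, Matrix.one_mul, Matrix.mul_one]
  rw [this, Matrix.det_mul, Matrix.det_mul, SetLike.mem_coe, Ideal.mem_span_singleton]
  exact Dvd.dvd.mul_right (dvd_mul_left _ _) _

end MinorIdeals

namespace MatEquiv

variable {R : Type*} [CommRing R] {l m : ℕ} {F G H : Matrix (Fin l) (Fin m) R}

theorem trans (h : MatEquiv F G) (h' : MatEquiv G H) : MatEquiv F H := by
  obtain ⟨M, N, hM, hN, rfl⟩ := h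
  obtain ⟨M', N', hM', hN', rfl⟩ := h'
  refine ⟨M' * M, N * N', ?_, ?_, by simp only [Matrix.mul_assoc]⟩
  · rw [Matrix.det_mul]; exact hM'.mul hM
  · rw [Matrix.det_mul]; exact hN.mul hN'

theorem smul (d : R) (h : MatEquiv F G) : MatEquiv (d • F) (d • G) := by
  obtain ⟨M, N, hM, hN, rfl⟩ := h
  exact ⟨M, N, hM, hN, by rw [Matrix.mul_smul, Matrix.smul_mul]⟩

theorem span_minorsSet_eq (h : MatEquiv F G) (k : ℕ) :
    Ideal.span (minorsSet k G) = Ideal.span (minorsSet k F) := by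
  obtain ⟨M, N, hM, hN, rfl⟩ := h
  apply le_antisymm
  · exact (span_minorsSet_mul_right_le _ _).trans (span_minorsSet_mul_left_le _ _)
  · have : F = M⁻¹ * (M * F * N) * N⁻¹ := by
      rw [← Matrix.mul_assoc, Matrix.nonsing_inv_mul_cancel_left _ _ hM,
        Matrix.mul_nonsing_inv_cancel_right _ _ hN]
    conv_lhs => rw [this]
    exact (span_minorsSet_mul_right_le _ _).trans (span_minorsSet_mul_left_le _ _)

end MatEquiv

/-- The block diagonal matrix with blocks `1` and `F`. -/
def oneBlock {R : Type*} [CommRing R] {l : ℕ} (F : Matrix (Fin l) (Fin l) R) :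
    Matrix (Fin (l + 1)) (Fin (l + 1)) R :=
  Matrix.of (Fin.cons (Fin.cons 1 0) fun i => Fin.cons 0 (F i))

section OneBlock

variable {R : Type*} [CommRing R] {l k : ℕ}

@[simp] theorem oneBlock_zero_zero (F : Matrix (Fin l) (Fin l) R) : oneBlock F 0 0 = 1 := rfl

@[simp] theorem oneBlock_zero_succ (F : Matrix (Fin l) (Fin l) R) (j : Fin l) :
    oneBlock F 0 j.succ = 0 := rfl

@[simp] theorem oneBlock_succ_zero (F : Matrix (Fin l) (Fin l) R) (i : Fin l) :
    oneBlock F i.succ 0 = 0 := rfl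

@[simp] theorem oneBlock_succ_succ (F : Matrix (Fin l) (Fin l) R) (i j : Fin l) :
    oneBlock F i.succ j.succ = F i j := rfl

theorem oneBlock_mul (F G : Matrix (Fin l) (Fin l) R) :
    oneBlock (F * G) = oneBlock F * oneBlock G := by
  ext i j
  refine Fin.cases ?_ (fun i => ?_) i <;> refine Fin.cases ?_ (fun j => ?_) j <;>
    simp [Matrix.mul_apply, Fin.sum_univ_succ]

theorem det_oneBlock (F : Matrix (Fin l) (Fin l) R) : (oneBlock F).det = F.det := by
  rw [Matrix.det_succ_row_zero, Fin.sum_univ_succ]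
  simp only [Fin.val_zero, pow_zero, oneBlock_zero_zero, oneBlock_zero_succ, mul_one, one_mul,
    mul_zero, zero_mul, Finset.sum_const_zero, add_zero]
  congr 1

theorem MatEquiv.oneBlock {F G : Matrix (Fin l) (Fin l) R} (h : MatEquiv F G) :
    MatEquiv (oneBlock F) (oneBlock G) := by
  obtain ⟨M, N, hM, hN, rfl⟩ := h
  exact ⟨_root_.oneBlock M, _root_.oneBlock N, by rwa [det_oneBlock], by rwa [det_oneBlock],
    by rw [oneBlock_mul, oneBlock_mul]⟩

theorem oneBlock_diagonal (d : Fin l → R) :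
    oneBlock (diagonal d) = diagonal (Fin.cons 1 d : Fin (l + 1) → R) := by
  ext i j
  refine Fin.cases ?_ (fun i => ?_) i <;> refine Fin.cases ?_ (fun j => ?_) j
  · simp
  · simp [(Fin.succ_ne_zero j).symm]
  · simp
  · by_cases h : i = j
    · subst h; simp
    · simp [h]

theorem span_minorsSet_oneBlock (F : Matrix (Fin l) (Fin l) R) :
    Ideal.span (minorsSet (k + 1) (oneBlock F)) = Ideal.span (minorsSet k F) := by
  apply le_antisymm
  · have key : ∀ ri ci : Fin k → Fin (l + 1), (∀ i, ri i ≠ 0) →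
        ((oneBlock F).submatrix ri ci).det ∈ Ideal.span (minorsSet k F) := by
      intro ri ci hri
      choose ri' hri' using fun i => Fin.exists_succ_eq_of_ne_zero (hri i)
      obtain rfl : (fun i => (ri' i).succ) = ri := funext hri'
      by_cases hci : ∃ j, ci j = 0
      · obtain ⟨j, hj⟩ := hci
        rw [Matrix.det_eq_zero_of_column_eq_zero j fun i => by simp [hj]]
        exact Ideal.zero_mem _
      · push Not at hci
        choose ci' hci' using fun i => Fin.exists_succ_eq_of_ne_zero (hci i)
        obtain rfl : (fun i => (ci' i).succ) = ci := funext hci'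
        exact det_submatrix_mem_span_minorsSet F ri' ci'
    rw [Ideal.span_le]
    rintro _ ⟨ri, ci, hr, -, rfl⟩
    obtain ⟨a, ha⟩ : ∃ a, ∀ i, ri (Fin.succAbove a i) ≠ 0 := by
      by_cases h : ∃ a, ri a = 0
      · obtain ⟨a, ha⟩ := h
        refine ⟨a, fun i hi => Fin.succAbove_ne a i (hr (hi.trans ha.symm))⟩
      · push Not at h
        exact ⟨0, fun i => h _⟩
    rw [Matrix.det_succ_row _ a]
    refine Ideal.sum_mem _ fun j _ => Ideal.mul_mem_left _ _ ?_
    rw [Matrix.submatrix_submatrix]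
    exact key _ _ ha
  · rw [Ideal.span_le]
    rintro _ ⟨ri, ci, -, -, rfl⟩
    have : (F.submatrix ri ci).det = ((oneBlock F).submatrix
        (Fin.cons 0 (Fin.succ ∘ ri)) (Fin.cons 0 (Fin.succ ∘ ci))).det := by
      rw [Matrix.det_succ_row_zero, Fin.sum_univ_succ]
      simp only [Matrix.submatrix_apply, Fin.cons_zero, Fin.cons_succ, Function.comp_apply,
        Fin.val_zero, pow_zero, oneBlock_zero_zero, oneBlock_zero_succ, mul_one, one_mul,
        mul_zero, zero_mul, Finset.sum_const_zero, add_zero]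
      congr 1
    rw [SetLike.mem_coe, this]
    exact det_submatrix_mem_span_minorsSet _ _ _

/-- A unimodular column with unimodular image splits off a block `1`. -/
theorem exists_matEquiv_oneBlock (hR : ColumnsCompletable R)
    (F : Matrix (Fin (l + 1)) (Fin (l + 1)) R) {u : Fin (l + 1) → R} (hu : UnimodularCol u)
    (hFu : UnimodularCol (F *ᵥ u)) :
    ∃ F' : Matrix (Fin l) (Fin l) R, MatEquiv F (oneBlock F') := by
  obtain ⟨Q, hQ⟩ := (hR l u hu).symm
  obtain ⟨P, hP⟩ := hR l _ hFu
  obtain ⟨G, hG⟩ : ∃ G : Matrix (Fin (l + 1)) (Fin (l + 1)) R, G = P * F * Q := ⟨_, rfl⟩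
  have hG0 : ∀ i, G i 0 = (Pi.single 0 1 : Fin (l + 1) → R) i := by
    intro i
    rw [← hP, ← hQ, Matrix.mulVec_mulVec, Matrix.mulVec_mulVec, ← hG]
    simp
  obtain ⟨b, hb⟩ : ∃ b : Fin (l + 1) → R, b = Fin.cons 0 fun j => G 0 j.succ := ⟨_, rfl⟩
  obtain ⟨B, hB⟩ : ∃ B : Matrix (Fin (l + 1)) (Fin (l + 1)) R,
      B = vecMulVec (Pi.single 0 1) b := ⟨_, rfl⟩
  have hBB : B * B = 0 := by
    rw [hB, vecMulVec_mul_vecMulVec]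
    simp [hb]
  have hdet : IsUnit (1 - B).det := by
    rw [← Matrix.isUnit_iff_isUnit_det]
    exact ⟨⟨1 - B, 1 + B, by simp [mul_add, sub_mul, hBB], by simp [mul_sub, add_mul, hBB]⟩, rfl⟩
  refine ⟨G.submatrix Fin.succ Fin.succ, P, Q * (1 - B), ?_, ?_, ?_⟩
  · exact (Matrix.isUnit_iff_isUnit_det _).1 P.isUnit
  · rw [Matrix.det_mul]
    exact ((Matrix.isUnit_iff_isUnit_det _).1 Q.isUnit).mul hdet
  · rw [← Matrix.mul_assoc, ← hG, mul_sub, mul_one]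
    ext i j
    have : (G * B) i j = (Pi.single 0 1 : Fin (l + 1) → R) i * b j := by
      rw [hB, Matrix.mul_vecMulVec, vecMulVec_apply]
      simp [hG0]
    rw [Matrix.sub_apply, this, hb]
    refine Fin.cases ?_ (fun i => ?_) i <;> refine Fin.cases ?_ (fun j => ?_) j <;> simp [hG0]

end OneBlock

namespace RetractionPair

variable {R : Type*} [CommRing R] [IsDomain R] {t₁ t₂ : R} {ρ₁ ρ₂ : R →+* R}

theorem le_of_dvd_left (h : RetractionPair t₁ t₂ ρ₁ ρ₂) (ht₁ : t₁ ≠ 0) (ht₂ : t₂ ≠ 0)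
    {a b c d : ℕ} (hdvd : t₁ ^ a * t₂ ^ b ∣ t₁ ^ c * t₂ ^ d) : a ≤ c := by
  by_contra! hlt
  obtain ⟨e, rfl⟩ := Nat.exists_eq_add_of_lt hlt
  have h1 : t₁ ^ c * t₁ ∣ t₁ ^ c * t₂ ^ d := by
    refine dvd_trans ?_ hdvd
    rw [← pow_succ]
    exact (pow_dvd_pow _ (by omega)).mul_right _
  obtain ⟨x, hx⟩ := (mul_dvd_mul_iff_left (pow_ne_zero c ht₁)).1 h1
  have := congrArg ρ₁ hx
  rw [map_pow, h.left_right, map_mul, h.left_left, zero_mul] at this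
  exact pow_ne_zero d ht₂ this

theorem le_of_dvd (h : RetractionPair t₁ t₂ ρ₁ ρ₂) (ht₁ : t₁ ≠ 0) (ht₂ : t₂ ≠ 0)
    {a b c d : ℕ} (hdvd : t₁ ^ a * t₂ ^ b ∣ t₁ ^ c * t₂ ^ d) : a ≤ c ∧ b ≤ d :=
  ⟨h.le_of_dvd_left ht₁ ht₂ hdvd,
    h.symm.le_of_dvd_left ht₂ ht₁ (by rwa [mul_comm (t₁ ^ _), mul_comm (t₁ ^ _)] at hdvd)⟩

theorem exponents_le_succ (h : RetractionPair t₁ t₂ ρ₁ ρ₂) (ht₁ : t₁ ≠ 0) (ht₂ : t₂ ≠ 0)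
    {l : ℕ} {F : Matrix (Fin l) (Fin l) R} {α β : ℕ → ℕ}
    (hF : ∀ k ≤ l, Ideal.span (minorsSet k F) = Ideal.span {t₁ ^ α k * t₂ ^ β k})
    {k : ℕ} (hk : k + 1 ≤ l) : α k ≤ α (k + 1) ∧ β k ≤ β (k + 1) := by
  refine h.le_of_dvd ht₁ ht₂ ?_
  rw [← Ideal.span_singleton_le_span_singleton, ← hF _ hk, ← hF k (by omega)]
  exact span_minorsSet_succ_le F

theorem exponents_mono (h : RetractionPair t₁ t₂ ρ₁ ρ₂) (ht₁ : t₁ ≠ 0) (ht₂ : t₂ ≠ 0)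
    {l : ℕ} {F : Matrix (Fin l) (Fin l) R} {α β : ℕ → ℕ}
    (hF : ∀ k ≤ l, Ideal.span (minorsSet k F) = Ideal.span {t₁ ^ α k * t₂ ^ β k})
    {i j : ℕ} (hij : i ≤ j) (hj : j ≤ l) : α i ≤ α j ∧ β i ≤ β j := by
  induction j, hij using Nat.le_induction with
  | base => exact ⟨le_rfl, le_rfl⟩
  | succ j hij ih =>
    have h1 := ih (by omega)
    have h2 := h.exponents_le_succ ht₁ ht₂ hF hj
    exact ⟨h1.1.trans h2.1, h1.2.trans h2.2⟩

theorem exists_unimodularCol_of_le (h : RetractionPair t₁ t₂ ρ₁ ρ₂)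
    (hR : IdempotentsSplit R) (ht₁ : t₁ ≠ 0) (ht₂ : t₂ ≠ 0)
    {l : ℕ} (F : Matrix (Fin l) (Fin l) R) {α β : ℕ → ℕ}
    (hF : ∀ k ≤ l, Ideal.span (minorsSet k F) = Ideal.span {t₁ ^ α k * t₂ ^ β k})
    (hone : Ideal.span (minorsSet 1 F) = ⊤) {r s : ℕ} (hrs : r ≤ s) (hs : s ≤ l)
    (hαr : α r = 0) (hβs : β s = 0) (hr' : r + 1 ≤ l → α (r + 1) ≠ 0)
    (hs' : s + 1 ≤ l → β (s + 1) ≠ 0) :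
    ∃ u : Fin l → R, UnimodularCol u ∧ UnimodularCol (F *ᵥ u) := by
  have hβr : β r = 0 := by
    have := (h.exponents_mono ht₁ ht₂ hF hrs hs).2
    omega
  have hdvd : ∀ {k}, k ≤ l → ∀ x ∈ minorsSet k F, t₁ ^ α k * t₂ ^ β k ∣ x := by
    intro k hk x hx
    rw [← Ideal.mem_span_singleton, ← hF k hk]
    exact Ideal.subset_span hx
  refine exists_unimodularCol_mulVec (r := r) (s := s) (N := α s) (e := α l) (f := β l)
    hR h ht₁ F hone ?_ ?_ ?_ ?_ ?_
  · rw [hF r (hrs.trans hs), hαr, hβr, pow_zero, pow_zero, mul_one, Ideal.span_singleton_one]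
  · intro x hx
    by_cases hl : r + 1 ≤ l
    · exact ((dvd_pow_self _ (hr' hl)).mul_right _).trans (hdvd hl x hx)
    · rw [minorsSet_eq_empty F (by omega)] at hx
      exact hx.elim
  · rw [hF s hs, hβs, pow_zero, mul_one]
  · intro x hx
    by_cases hl : s + 1 ≤ l
    · exact ((dvd_pow_self _ (hs' hl)).mul_left _).trans (hdvd hl x hx)
    · rw [minorsSet_eq_empty F (by omega)] at hx
      exact hx.elim
  · exact det_dvd_of_mem_span_minorsSet F (hF l le_rfl ▸ Ideal.mem_span_singleton_self _)

theorem exists_unimodularCol (h : RetractionPair t₁ t₂ ρ₁ ρ₂)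
    (hR : IdempotentsSplit R) (ht₁ : t₁ ≠ 0) (ht₂ : t₂ ≠ 0)
    {l : ℕ} (F : Matrix (Fin l) (Fin l) R) {α β : ℕ → ℕ} (hα : α 0 = 0) (hβ : β 0 = 0)
    (hF : ∀ k ≤ l, Ideal.span (minorsSet k F) = Ideal.span {t₁ ^ α k * t₂ ^ β k})
    (hone : Ideal.span (minorsSet 1 F) = ⊤) :
    ∃ u : Fin l → R, UnimodularCol u ∧ UnimodularCol (F *ᵥ u) := by
  obtain ⟨r, hr, hαr, hr_succ⟩ : ∃ r ≤ l, α r = 0 ∧ (r + 1 ≤ l → α (r + 1) ≠ 0) :=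
    ⟨Nat.findGreatest (α · = 0) l, Nat.findGreatest_le l,
      Nat.findGreatest_spec (P := (α · = 0)) (Nat.zero_le l) hα,
      fun hl => Nat.findGreatest_is_greatest (P := (α · = 0)) (Nat.lt_succ_self _) hl⟩
  obtain ⟨s, hs, hβs, hs_succ⟩ : ∃ s ≤ l, β s = 0 ∧ (s + 1 ≤ l → β (s + 1) ≠ 0) :=
    ⟨Nat.findGreatest (β · = 0) l, Nat.findGreatest_le l,
      Nat.findGreatest_spec (P := (β · = 0)) (Nat.zero_le l) hβ,
      fun hl => Nat.findGreatest_is_greatest (P := (β · = 0)) (Nat.lt_succ_self _) hl⟩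
  rcases le_total r s with hrs | hsr
  · exact h.exists_unimodularCol_of_le hR ht₁ ht₂ F hF hone hrs hs hαr hβs hr_succ hs_succ
  · exact h.symm.exists_unimodularCol_of_le hR ht₂ ht₁ F
      (fun k hk => by rw [hF k hk, mul_comm]) hone hsr hr hβs hαr hs_succ hr_succ

/-- A matrix all of whose ideals of minors are generated by monomials in `t₁, t₂` is equivalent
to its Smith normal form. -/
theorem matEquiv_smith (h : RetractionPair t₁ t₂ ρ₁ ρ₂) (hR : IdempotentsSplit R)
    (hR' : ColumnsCompletable R) (ht₁ : t₁ ≠ 0) (ht₂ : t₂ ≠ 0) {l : ℕ}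
    (F : Matrix (Fin l) (Fin l) R) {α β : ℕ → ℕ} (hα : α 0 = 0) (hβ : β 0 = 0)
    (hF : ∀ k ≤ l, Ideal.span (minorsSet k F) = Ideal.span {t₁ ^ α k * t₂ ^ β k}) :
    MatEquiv F (diagonal fun i : Fin l =>
      t₁ ^ (α ((i : ℕ) + 1) - α i) * t₂ ^ (β ((i : ℕ) + 1) - β i)) ∧
    ∀ i, i + 2 ≤ l → α (i + 1) - α i ≤ α (i + 2) - α (i + 1) ∧
      β (i + 1) - β i ≤ β (i + 2) - β (i + 1) := by
  induction l generalizing α β with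
  | zero =>
    exact ⟨⟨1, 1, by simp, by simp, Subsingleton.elim _ _⟩, fun i hi => by omega⟩
  | succ l ih =>
    obtain ⟨d, hd⟩ : ∃ d, d = t₁ ^ α 1 * t₂ ^ β 1 := ⟨_, rfl⟩
    have hd0 : d ≠ 0 := hd ▸ mul_ne_zero (pow_ne_zero _ ht₁) (pow_ne_zero _ ht₂)
    have hdF : ∀ i j, d ∣ F i j := by
      intro i j
      rw [← Ideal.mem_span_singleton, hd, ← hF 1 (by omega)]
      exact Ideal.subset_span (apply_mem_minorsSet_one F i j)
    choose F₀ hF₀ using hdF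
    have hFd : F = d • Matrix.of F₀ := by
      ext i j
      exact hF₀ i j
    have hle : ∀ k ≤ l + 1, k * α 1 ≤ α k ∧ k * β 1 ≤ β k := by
      intro k hk
      refine h.le_of_dvd ht₁ ht₂ ?_
      have : t₁ ^ (k * α 1) * t₂ ^ (k * β 1) = d ^ k := by
        rw [hd, mul_pow, ← pow_mul, ← pow_mul, mul_comm k, mul_comm k]
      rw [this, ← Ideal.span_singleton_le_span_singleton, ← hF k hk, hFd, span_minorsSet_smul]
      exact Ideal.mul_le_left
    have hF₀' : ∀ k ≤ l + 1, Ideal.span (minorsSet k (Matrix.of F₀)) =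
        Ideal.span {t₁ ^ (α k - k * α 1) * t₂ ^ (β k - k * β 1)} := by
      intro k hk
      rw [← Ideal.span_singleton_mul_right_inj (pow_ne_zero k hd0), ← span_minorsSet_smul, ← hFd,
        hF k hk, Ideal.span_singleton_mul_span_singleton, hd]
      obtain ⟨a, ha⟩ := Nat.exists_eq_add_of_le (hle k hk).1
      obtain ⟨b, hb⟩ := Nat.exists_eq_add_of_le (hle k hk).2
      rw [ha, hb, Nat.add_sub_cancel_left, Nat.add_sub_cancel_left]
      congr 2
      ring
    obtain ⟨u, hu, hFu⟩ := h.exists_unimodularCol hR ht₁ ht₂ (Matrix.of F₀)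
      (α := fun k => α k - k * α 1) (β := fun k => β k - k * β 1) (by simp [hα]) (by simp [hβ])
      hF₀' (by rw [hF₀' 1 (by omega)]; simp)
    obtain ⟨F', hF'⟩ := exists_matEquiv_oneBlock hR' _ hu hFu
    have hspan : ∀ k ≤ l, Ideal.span (minorsSet k F') =
        Ideal.span {t₁ ^ (α (k + 1) - (k + 1) * α 1) * t₂ ^ (β (k + 1) - (k + 1) * β 1)} := by
      intro k hk
      rw [← span_minorsSet_oneBlock, hF'.span_minorsSet_eq, hF₀' (k + 1) (by omega)]
    obtain ⟨h1, h2⟩ := ih F' (α := fun k => α (k + 1) - (k + 1) * α 1)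
      (β := fun k => β (k + 1) - (k + 1) * β 1) (by simp) (by simp) hspan
    have hstep : ∀ k, k + 1 ≤ l →
        α (k + 2) - α (k + 1) =
          α 1 + (α (k + 2) - (k + 2) * α 1 - (α (k + 1) - (k + 1) * α 1)) ∧
        β (k + 2) - β (k + 1) =
          β 1 + (β (k + 2) - (k + 2) * β 1 - (β (k + 1) - (k + 1) * β 1)) := by
      intro k hk
      obtain ⟨h3, h4⟩ := h.exponents_le_succ ht₁ ht₂
        (α := fun k => α (k + 1) - (k + 1) * α 1) (β := fun k => β (k + 1) - (k + 1) * β 1)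
        hspan hk
      obtain ⟨h5, h6⟩ := hle (k + 1) (by omega)
      obtain ⟨h7, h8⟩ := hle (k + 2) (by omega)
      have e1 : (k + 2) * α 1 = (k + 1) * α 1 + α 1 := by ring
      have e2 : (k + 2) * β 1 = (k + 1) * β 1 + β 1 := by ring
      simp only [add_assoc, Nat.reduceAdd] at h3 h4
      constructor <;> omega
    refine ⟨?_, ?_⟩
    · have h3 := (hF'.trans h1.oneBlock).smul d
      rw [← hFd, oneBlock_diagonal] at h3
      convert h3 using 1
      rw [← Matrix.diagonal_smul]
      congr 1
      ext i
      refine Fin.cases ?_ (fun i => ?_) i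
      · simp [hα, hβ, hd]
      · obtain ⟨h4, h5⟩ := hstep i (by omega)
        simp only [Fin.val_succ, Pi.smul_apply, Fin.cons_succ, smul_eq_mul, add_assoc,
          Nat.reduceAdd] at *
        rw [h4, h5, hd]
        ring
    · intro i hi
      rcases i with _ | i
      · obtain ⟨h4, h5⟩ := hstep 0 (by omega)
        simp only [zero_add, hα, hβ] at *
        omega
      · obtain ⟨h4, h5⟩ := hstep i (by omega)
        obtain ⟨h6, h7⟩ := hstep (i + 1) (by omega)
        obtain ⟨h8, h9⟩ := h2 i (by omega)
        simp only [add_assoc, Nat.reduceAdd] at *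
        constructor <;> omega

end RetractionPair

theorem MvPolynomial.algHom_apply_eq_of_mem_supported {K σ A : Type*} [CommSemiring K]
    [Semiring A] [Algebra K A] {s : Set σ} {f : MvPolynomial σ K} (hf : f ∈ supported K s)
    {φ ψ : MvPolynomial σ K →ₐ[K] A} (h : ∀ i ∈ s, φ (X i) = ψ (X i)) : φ f = ψ f := by
  have : supported K s ≤ AlgHom.equalizer φ ψ := by
    rw [supported, Algebra.adjoin_le_iff]
    rintro _ ⟨i, hi, rfl⟩
    exact h i hi
  exact this hf

theorem MvPolynomial.dvd_sub_algHom_apply {K σ : Type*} [CommRing K]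
    (φ : MvPolynomial σ K →ₐ[K] MvPolynomial σ K) {t : MvPolynomial σ K}
    (h : ∀ i, t ∣ X i - φ (X i)) (g : MvPolynomial σ K) : t ∣ g - φ g := by
  induction g using MvPolynomial.induction_on with
  | C a => simp [← MvPolynomial.algebraMap_eq]
  | add p q hp hq =>
    rw [map_add, add_sub_add_comm]
    exact dvd_add hp hq
  | mul_X p i hp =>
    have : p * X i - φ (p * X i) = (p - φ p) * X i + φ p * (X i - φ (X i)) := by
      rw [map_mul]; ring
    rw [this]
    exact dvd_add (hp.mul_right _) ((h i).mul_left _)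

/-- The substitutions `x₁ = f₁` and `x₂ = f₂` extend to commuting retractions. -/
theorem exists_retractionPair {K σ : Type*} [Field K] {v w : σ} (hvw : v ≠ w)
    {f g : MvPolynomial σ K} (hf : f ∈ supported K ({v} : Set σ)ᶜ)
    (hg : g ∈ supported K ({v, w} : Set σ)ᶜ) :
    ∃ ρ₁ ρ₂ : MvPolynomial σ K →+* MvPolynomial σ K,
      RetractionPair (X v - f) (X w - g) ρ₁ ρ₂ := by
  classical
  let τ : MvPolynomial σ K →ₐ[K] MvPolynomial σ K := aeval (Function.update X w g)
  let ρ : MvPolynomial σ K →ₐ[K] MvPolynomial σ K := aeval (Function.update X v f)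
  let π : MvPolynomial σ K →ₐ[K] MvPolynomial σ K :=
    aeval (Function.update (Function.update X w g) v (X v - f + τ f))
  have hτw : τ (X w) = g := by simp [τ]
  have hτ : ∀ i, i ≠ w → τ (X i) = X i := fun i hi => by simp [τ, hi]
  have hρv : ρ (X v) = f := by simp [ρ]
  have hρ : ∀ i, i ≠ v → ρ (X i) = X i := fun i hi => by simp [ρ, hi]
  have hπv : π (X v) = X v - f + τ f := by simp [π]
  have hπw : π (X w) = g := by simp [π, hvw.symm]
  have hπ : ∀ i, i ≠ v → i ≠ w → π (X i) = X i := fun i hi hi' => by simp [π, hi, hi']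
  have hρf : ρ f = f :=
    algHom_apply_eq_of_mem_supported (ψ := AlgHom.id K _) hf fun i hi => hρ i hi
  have hρg : ρ g = g :=
    algHom_apply_eq_of_mem_supported (ψ := AlgHom.id K _) hg fun i hi => hρ i (by grind)
  have hπg : π g = g :=
    algHom_apply_eq_of_mem_supported (ψ := AlgHom.id K _) hg fun i hi => hπ i (by grind) (by grind)
  have hπf : π f = τ f := algHom_apply_eq_of_mem_supported hf fun i hi => by
    by_cases h : i = w
    · rw [h, hπw, hτw]
    · rw [hπ i hi h, hτ i h]
  have hρτf : ρ (τ f) = τ f :=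
    algHom_apply_eq_of_mem_supported (φ := ρ.comp τ) hf fun i hi => by
      rw [AlgHom.comp_apply]
      by_cases h : i = w
      · rw [h, hτw, hρg]
      · rw [hτ i h, hρ i hi]
  have hτdvd : X w - g ∣ f - τ f := by
    refine dvd_sub_algHom_apply τ (fun i => ?_) f
    by_cases h : i = w
    · rw [h, hτw]
    · simp [hτ i h]
  have hcomm : ρ.comp π = π.comp ρ := by
    refine MvPolynomial.algHom_ext fun i => ?_
    simp only [AlgHom.comp_apply]
    by_cases hv : i = v
    · rw [hv, hπv, hρv, map_add, map_sub, hρv, hρf, hρτf, hπf, sub_self, zero_add]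
    · by_cases hw : i = w
      · rw [hw, hπw, hρ w hvw.symm, hρg, hπw]
      · rw [hπ i hv hw, hρ i hv, hπ i hv hw]
  refine ⟨ρ.toRingHom, π.toRingHom, ?_, ?_, ?_, ?_, ?_, ?_, ?_⟩
  · refine dvd_sub_algHom_apply ρ fun i => ?_
    by_cases h : i = v
    · rw [h, hρv]
    · simp [hρ i h]
  · refine dvd_sub_algHom_apply π fun i => ?_
    by_cases hv : i = v
    · rw [hv, hπv]
      convert hτdvd using 1
      ring
    · by_cases hw : i = w
      · rw [hw, hπw]
      · simp [hπ i hv hw]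
  · change ρ _ = _
    rw [map_sub, hρv, hρf, sub_self]
  · change ρ _ = _
    rw [map_sub, hρ w hvw.symm, hρg]
  · change π _ = _
    rw [map_sub, hπv, hπf, add_sub_cancel_right]
  · change π _ = _
    rw [map_sub, hπw, hπg, sub_self]
  · exact fun x => AlgHom.congr_fun hcomm x

theorem span_minorsSet_eq_of_jEqTop {R : Type*} [CommRing R] [IsDomain R] {l m k : ℕ}
    {F : Matrix (Fin l) (Fin m) R} (h : JEqTop k F) :
    ∃ d, IsGcdMinors k F d ∧ Ideal.span (minorsSet k F) = Ideal.span {d} := by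
  obtain ⟨d, hd, hJ⟩ := h
  refine ⟨d, hd, le_antisymm ?_ ?_⟩
  · rw [Ideal.span_le]
    exact fun x hx => Ideal.mem_span_singleton.2 (hd.1 x hx)
  · have : Ideal.span {d} * Ideal.span { b : R | d * b ∈ minorsSet k F } ≤
        Ideal.span (minorsSet k F) := by
      rw [Ideal.span_mul_span', Ideal.span_le]
      rintro _ ⟨_, rfl, b, hb, rfl⟩
      exact Ideal.subset_span hb
    rwa [hJ, Ideal.mul_top] at this

theorem MvPolynomial.X_sub_ne_zero_of_mem_supported {K σ : Type*} [Field K] {v : σ} {s : Set σ}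
    (hv : v ∉ s) {f : MvPolynomial σ K} (hf : f ∈ supported K s) : X v - f ≠ 0 := by
  intro h
  rw [← sub_eq_zero.1 h, X_mem_supported] at hf
  exact hv hf

theorem statement17 {K : Type*} [Field K] {n l : ℕ}
    (v1 v2 : Fin n) (hv1 : (v1 : ℕ) = 0) (hv2 : (v2 : ℕ) = 1)
    (f1 f2 : MvPolynomial (Fin n) K)
    (hf1 : f1 ∈ MvPolynomial.supported K (({v1} : Set (Fin n))ᶜ))
    (hf2 : f2 ∈ MvPolynomial.supported K (({v1, v2} : Set (Fin n))ᶜ))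
    (F : Matrix (Fin l) (Fin l) (MvPolynomial (Fin n) K))
    (p q : ℕ) (hp : 0 < p) (hq : 0 < q)
    (hdet : Associated F.det ((X v1 - f1) ^ p * (X v2 - f2) ^ q))
    (pk qk : ℕ → ℕ) (hpk0 : pk 0 = 0) (hqk0 : qk 0 = 0)
    (hd : ∀ i, 1 ≤ i → i ≤ l → ∀ d, IsGcdMinors i F d →
      Associated d ((X v1 - f1) ^ pk i * (X v2 - f2) ^ qk i))
    (hJ : ∀ i, 1 ≤ i → i ≤ l → JEqTop i F) :
    MatEquiv F (Matrix.diagonal (fun i : Fin l =>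
      (X v1 - f1) ^ (pk ((i : ℕ) + 1) - pk (i : ℕ)) *
        (X v2 - f2) ^ (qk ((i : ℕ) + 1) - qk (i : ℕ)))) ∧
    (∀ i j, 1 ≤ i → i ≤ j → j ≤ l →
      pk i - pk (i - 1) ≤ pk j - pk (j - 1) ∧ qk i - qk (i - 1) ≤ qk j - qk (j - 1)) := by
  have hvw : v1 ≠ v2 := by
    rintro rfl
    omega
  obtain ⟨ρ₁, ρ₂, h⟩ := exists_retractionPair hvw hf1 hf2
  have hF : ∀ k ≤ l, Ideal.span (minorsSet k F) =
      Ideal.span {(X v1 - f1) ^ pk k * (X v2 - f2) ^ qk k} := by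
    intro k hk
    rcases Nat.eq_zero_or_pos k with rfl | hk0
    · rw [minorsSet_zero, hpk0, hqk0, pow_zero, pow_zero, mul_one]
    · obtain ⟨d, hgcd, hspan⟩ := span_minorsSet_eq_of_jEqTop (hJ k hk0 hk)
      rw [hspan, Ideal.span_singleton_eq_span_singleton]
      exact hd k hk0 hk d hgcd
  obtain ⟨h1, h2⟩ := h.matEquiv_smith (idempotentsSplit_mvPolynomial n K)
    (columnsCompletable_mvPolynomial K n) (X_sub_ne_zero_of_mem_supported (by simp) hf1)
    (X_sub_ne_zero_of_mem_supported (by simp) hf2) F hpk0 hqk0 hF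
  refine ⟨h1, fun i j hi hij hj => ?_⟩
  induction j, hij using Nat.le_induction with
  | base => exact ⟨le_rfl, le_rfl⟩
  | succ j hij ih =>
    obtain ⟨j, rfl⟩ := Nat.exists_eq_add_of_le' (hi.trans hij)
    obtain ⟨h3, h4⟩ := ih (by omega)
    obtain ⟨h5, h6⟩ := h2 j hj
    exact ⟨h3.trans h5, h4.trans h6⟩
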